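/- Let p be a prime with p ≡ 1 (mod 4), and write p = x^2 + 4y^2 with integers x, y. Then Σ_{k=0}^{p−1} k^2·C(2k,k)^3/64^k ≡ x^2/6 − p/12 − p^2/(24x^2) (mod p^3). -/

import Mathlib

/-- `a ≡ b (mod p^r)` for rationals: the numerator of `a - b` in lowest terms
is divisible by `p^r`. -/
def ratCongr (p r : ℕ) (a b : ℚ) : Prop := (p : ℤ)^r ∣ (a - b).num

open Finset

/-! ### Hypergeometric identities -/

lemma whipple_step (S : ℚ) (hS : ∀ i : ℕ, ((i:ℚ)+1)^2 - S ≠ 0) (n : ℕ) (j : ℕ) :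
    ∑ k ∈ range (j+2), ((((n:ℚ)+2)^2 - S) * ∏ i ∈ range k,
        (((i:ℚ) - (n+2)) * ((n+2)+1+i) * ((i+1/2) / ((i+1) * ((i+1)^2 - S))))
      - (((n:ℚ)+1)^2 - S) * ∏ i ∈ range k,
        (((i:ℚ) - n) * (n+1+i) * ((i+1/2) / ((i+1) * ((i+1)^2 - S)))))
    = -2*(2*n+3)*(n+1)*(n+2)*(∏ i ∈ range j, (((i:ℚ) - n) * (n+3+i)))
        * (∏ i ∈ range (j+1), (((i:ℚ)+1/2) / ((i+1) * ((i+1)^2 - S)))) * (j+3/2) := by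
  have e1 : ∀ j : ℕ, ∏ i ∈ range (j+2), (((i:ℚ) - (n+2)) * ((n+2)+1+i)) =
      (n+2)*(n+1)*(∏ i ∈ range j, (((i:ℚ) - n) * (n+3+i))) * (n+3+j)*(n+4+j) := by
    intro j
    induction j with
    | zero => simp [prod_range_succ]; ring
    | succ j ih => rw [prod_range_succ, ih, prod_range_succ]; push_cast; ring
  have e2 : ∀ j : ℕ, ∏ i ∈ range (j+2), (((i:ℚ) - n) * (n+1+i)) =
      (n+2)*(n+1)*(∏ i ∈ range j, (((i:ℚ) - n) * (n+3+i))) * (j-n)*(j+1-n) := by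
    intro j
    induction j with
    | zero => simp [prod_range_succ]; ring
    | succ j ih => rw [prod_range_succ, ih, prod_range_succ]; push_cast; ring
  induction j with
  | zero =>
    have := hS 0
    simp [sum_range_succ, prod_range_succ] at this ⊢
    field_simp
    ring
  | succ j ih =>
    rw [sum_range_succ, ih]
    have d1 : ∏ i ∈ range (j+2),
        (((i:ℚ) - (n+2)) * ((n+2)+1+i) * ((i+1/2) / ((i+1) * ((i+1)^2 - S)))) = _ :=
      prod_mul_distrib
    have d2 : ∏ i ∈ range (j+2),
        (((i:ℚ) - n) * (n+1+i) * ((i+1/2) / ((i+1) * ((i+1)^2 - S)))) = _ :=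
      prod_mul_distrib
    rw [d1, d2, e1, e2, prod_range_succ _ (j+1), prod_range_succ _ j]
    have := hS j
    have := hS (j+1)
    push_cast at this ⊢
    have h3 : (j:ℚ)+1+1 ≠ 0 := by positivity
    have h4 : (j:ℚ)+1 ≠ 0 := by positivity
    rw [prod_range_succ]
    generalize (∏ i ∈ range j, (((i:ℚ) - n) * (n+3+i))) = Z
    generalize (∏ i ∈ range j, (((i:ℚ)+1/2) / ((i+1) * ((i+1)^2 - S)))) = W
    field_simp
    ring

lemma whipple (S : ℚ) (hS : ∀ i : ℕ, ((i:ℚ)+1)^2 - S ≠ 0) (m : ℕ) :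
    ∑ k ∈ range (2*m+1), ∏ i ∈ range k,
        (((i:ℚ) - (2*m:ℕ)) * ((2*m:ℕ)+1+i) * ((i+1/2) / ((i+1) * ((i+1)^2 - S))))
    = ∏ i ∈ range m, (((2*i+1:ℚ)^2 - S) / ((2*i+2:ℚ)^2 - S)) := by
  induction m with
  | zero => simp
  | succ m ih =>
    have h := whipple_step S hS (2*m) (2*m+1)
    have hz : ∏ i ∈ range (2*m+1), (((i:ℚ) - (2*m:ℕ)) * ((2*m:ℕ)+3+i)) = 0 :=
      prod_eq_zero (i := 2*m) (by simp) (by simp)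
    rw [hz, sum_sub_distrib, ← mul_sum, ← mul_sum] at h
    have h2 : ∀ k, 2*m+1 ≤ k → ∏ i ∈ range k,
        (((i:ℚ) - (2*m:ℕ)) * ((2*m:ℕ)+1+i) * ((i+1/2) / ((i+1) * ((i+1)^2 - S)))) = 0 := by
      intro k hk
      exact prod_eq_zero (i := 2*m) (by simp; omega) (by simp)
    rw [sum_range_succ (n := 2*m+1+1) (f := fun k => ∏ i ∈ range k,
        (((i:ℚ) - (2*m:ℕ)) * ((2*m:ℕ)+1+i) * ((i+1/2) / ((i+1) * ((i+1)^2 - S))))),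
      sum_range_succ (n := 2*m+1) (f := fun k => ∏ i ∈ range k,
        (((i:ℚ) - (2*m:ℕ)) * ((2*m:ℕ)+1+i) * ((i+1/2) / ((i+1) * ((i+1)^2 - S))))),
        h2 _ (le_refl _), h2 _ (by omega), ih] at h
    rw [prod_range_succ]
    have h5 := hS (2*m+1)
    have e : (2*(m+1) : ℕ) = 2*m+2 := by ring
    rw [e]
    push_cast at h h5 ⊢
    have e3 : (2*(m:ℚ)+1+1) = 2*m+2 := by ring
    rw [e3] at h5
    rw [← mul_div_assoc, eq_div_iff h5]
    linear_combination h

lemma dougall_step (j : ℕ) (l : ℕ) :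
    ∑ k ∈ range (l+1), ((4*(j:ℚ)+3)*(2*j+1) * ((4*k+1) * ∏ i ∈ range k,
        (((i:ℚ)+1/2)/(i+1) * (((i:ℚ)-(j+1)) * ((j+1)+1+i) / ((i+1/2-(j+1)) * ((j+1)+3/2+i)))))
      - (2*j+3)*(4*j+5) * ((4*k+1) * ∏ i ∈ range k,
        (((i:ℚ)+1/2)/(i+1) * (((i:ℚ)-j) * (j+1+i) / ((i+1/2-j) * (j+3/2+i))))))
    = -4 * (∏ i ∈ range l, (((i:ℚ)+1/2)/(i+1) * (((i:ℚ)-j) * (j+2+i) / ((i+1/2-j) * (j+5/2+i)))))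
      * (2*l+1)*(j+1)*(4*l+3) := by
  have hne : ∀ i : ℕ, (i:ℚ)+1/2-j ≠ 0 := by
    intro i h
    have : (2*(i:ℚ)+1) = 2*j := by linarith
    have : 2*i+1 = 2*j := by exact_mod_cast this
    omega
  have hj : (-1/2:ℚ)-j ≠ 0 := by
    have : (0:ℚ) ≤ j := by positivity
    linarith
  have e1 : ∀ l : ℕ, ∏ i ∈ range (l+1), (((i:ℚ)+1/2)/(i+1) * (((i:ℚ)-(j+1)) * ((j+1)+1+i) / ((i+1/2-(j+1)) * ((j+1)+3/2+i)))) =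
      (∏ i ∈ range l, (((i:ℚ)+1/2)/(i+1) * (((i:ℚ)-j) * (j+2+i) / ((i+1/2-j) * (j+5/2+i))))) * ((l+1/2)/(l+1)) * ((-j-1)*(j+2+l)/((-1/2-j)*(j+5/2+l))) := by
    intro l
    induction l with
    | zero => 
      have : (2⁻¹ : ℚ) - (j+1) = -1/2 - j := by ring
      simp [prod_range_succ, this]
      field_simp
      ring
    | succ l ih =>
      rw [prod_range_succ, ih, prod_range_succ]
      have h1 := hne l
      have h2 : ((l+1:ℕ):ℚ) + 1/2 - (j+1) = l + 1/2 - j := by push_cast; ring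
      rw [h2]
      push_cast
      generalize (∏ i ∈ range l, (((i:ℚ)+1/2)/(i+1) * (((i:ℚ)-j) * (j+2+i) / ((i+1/2-j) * (j+5/2+i))))) = Z
      have e : (l:ℚ)+1/2-j = (2*l+1-2*j)/2 := by ring
      have h3 : (2*(l:ℚ)+1-2*j) ≠ 0 := by intro h; apply h1; rw [e, h]; simp
      have e' : (-1/2:ℚ)-j = -(2*j+1)/2 := by ring
      rw [e, e']
      field_simp
      ring
  have e2 : ∀ l : ℕ, ∏ i ∈ range (l+1), (((i:ℚ)+1/2)/(i+1) * (((i:ℚ)-j) * (j+1+i) / ((i+1/2-j) * (j+3/2+i)))) =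
      (∏ i ∈ range l, (((i:ℚ)+1/2)/(i+1) * (((i:ℚ)-j) * (j+2+i) / ((i+1/2-j) * (j+5/2+i))))) * ((l+1/2)/(l+1)) * ((l-j)*(j+1)/((l+1/2-j)*(j+3/2))) := by
    intro l
    induction l with
    | zero => 
      simp [prod_range_succ]
    | succ l ih =>
      rw [prod_range_succ, ih, prod_range_succ]
      have h1 := hne l
      have h2 := hne (l+1)
      push_cast at h2 ⊢
      generalize (∏ i ∈ range l, (((i:ℚ)+1/2)/(i+1) * (((i:ℚ)-j) * (j+2+i) / ((i+1/2-j) * (j+5/2+i))))) = Z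
      generalize hd : (l:ℚ)+1/2-j = d at *
      generalize hd' : (l:ℚ)+1+1/2-j = d' at *
      have h5 : (j:ℚ)+3/2+(l+1) = (2*j+5+2*l)/2 := by ring
      have h6 : (j:ℚ)+5/2+l = (2*j+5+2*l)/2 := by ring
      rw [h5, h6]
      field_simp
      ring
  induction l with
  | zero => simp; ring
  | succ l ih =>
    rw [sum_range_succ, ih, e1, e2, prod_range_succ]
    have h1 := hne l
    generalize (∏ i ∈ range l, (((i:ℚ)+1/2)/(i+1) * (((i:ℚ)-j) * (j+2+i) / ((i+1/2-j) * (j+5/2+i))))) = Z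
    have e : (l:ℚ)+1/2-j = (2*l+1-2*j)/2 := by ring
    have h3 : (2*(l:ℚ)+1-2*j) ≠ 0 := by intro h; apply h1; rw [e, h]; simp
    have e' : (-1/2:ℚ)-j = -(2*j+1)/2 := by ring
    rw [e, e']
    push_cast
    field_simp
    ring

lemma dougall (j : ℕ) :
    ∑ k ∈ range (j+1), ((4*(k:ℚ)+1) * ∏ i ∈ range k,
        (((i:ℚ)+1/2)/(i+1) * (((i:ℚ)-j) * (j+1+i) / ((i+1/2-j) * (j+3/2+i)))))
    = (2*j+1) * ∏ i ∈ range j, ((4*(i:ℚ)+5)/(4*i+3)) := by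
  induction j with
  | zero => simp
  | succ j ih =>
    have h := dougall_step j (j+1)
    have hz : ∏ i ∈ range (j+1), (((i:ℚ)+1/2)/(i+1) * (((i:ℚ)-j) * (j+2+i) / ((i+1/2-j) * (j+5/2+i)))) = 0 :=
      prod_eq_zero (i := j) (by simp) (by simp)
    rw [hz, sum_sub_distrib, ← mul_sum, ← mul_sum, sum_range_succ (n := j+1) (f := fun k => (4*(k:ℚ)+1) * ∏ i ∈ range k,
        (((i:ℚ)+1/2)/(i+1) * (((i:ℚ)-j) * (j+1+i) / ((i+1/2-j) * (j+3/2+i))))), ih] at h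
    have hz2 : ∏ i ∈ range (j+1), (((i:ℚ)+1/2)/(i+1) * (((i:ℚ)-j) * (j+1+i) / ((i+1/2-j) * (j+3/2+i)))) = 0 :=
      prod_eq_zero (i := j) (by simp) (by simp)
    rw [hz2] at h
    rw [prod_range_succ]
    push_cast at h ⊢
    generalize ∏ i ∈ range j, ((4*(i:ℚ)+5)/(4*i+3)) = Z at *
    have hu : ((4*(j:ℚ)+3)*(2*j+1)) ≠ 0 := by positivity
    apply mul_left_cancel₀ hu
    rw [sub_eq_iff_eq_add] at h
    rw [h]
    field_simp
    ring

/-! ### p-integral rationals and congruences -/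

/-- The subring of `p`-integral rationals. -/
def OO (p : ℕ) [hp : Fact p.Prime] : Subring ℚ where
  carrier := {q | ∃ a b : ℤ, ¬ (p:ℤ) ∣ b ∧ q * b = a}
  mul_mem' := by
    rintro x y ⟨a, b, hb, h⟩ ⟨c, d, hd, h'⟩
    refine ⟨a*c, b*d, ?_, ?_⟩
    · intro hh
      rcases (Nat.prime_iff_prime_int.mp hp.out).dvd_or_dvd hh with h1 | h1 <;> tauto
    · push_cast; rw [← h, ← h']; ring
  one_mem' := ⟨1, 1, by
    intro h
    have := Int.eq_one_of_dvd_one (by positivity) h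
    have h2 := hp.out.one_lt
    omega, by simp⟩
  add_mem' := by
    rintro x y ⟨a, b, hb, h⟩ ⟨c, d, hd, h'⟩
    refine ⟨a*d+c*b, b*d, ?_, ?_⟩
    · intro hh
      rcases (Nat.prime_iff_prime_int.mp hp.out).dvd_or_dvd hh with h1 | h1 <;> tauto
    · push_cast; rw [← h, ← h']; ring
  zero_mem' := ⟨0, 1, by
    intro h
    have := Int.eq_one_of_dvd_one (by positivity) h
    have h2 := hp.out.one_lt
    omega, by simp⟩
  neg_mem' := by
    rintro x ⟨a, b, hb, h⟩
    exact ⟨-a, b, hb, by push_cast; rw [← h]; ring⟩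

lemma OO_int_inv {p : ℕ} [hp : Fact p.Prime] {b : ℤ} (hb : ¬ (p:ℤ) ∣ b) : (b:ℚ)⁻¹ ∈ OO p := by
  refine ⟨1, b, hb, ?_⟩
  have : (b:ℚ) ≠ 0 := by
    intro h
    apply hb
    have : b = 0 := by exact_mod_cast h
    simp [this]
  push_cast
  exact inv_mul_cancel₀ this

lemma OO_nat_inv {p : ℕ} [hp : Fact p.Prime] {b : ℕ} (hb : ¬ p ∣ b) : (b:ℚ)⁻¹ ∈ OO p := by
  have := OO_int_inv (p := p) (b := (b:ℤ)) (by exact_mod_cast hb)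
  exact_mod_cast this

/-- Congruence modulo `p^r` among rationals. -/
def cg (p : ℕ) [Fact p.Prime] (r : ℕ) (a b : ℚ) : Prop := ∃ z ∈ OO p, a - b = (p:ℚ)^r * z

section
variable {p : ℕ} [hp : Fact p.Prime] {r : ℕ} {a b c d : ℚ}

lemma cg.refl (a : ℚ) : cg p r a a := ⟨0, zero_mem _, by simp⟩
lemma cg.of_eq (h : a = b) : cg p r a b := h ▸ cg.refl a
lemma cg.symm (h : cg p r a b) : cg p r b a := by
  obtain ⟨z, hz, h⟩ := h
  exact ⟨-z, neg_mem hz, by linear_combination -h⟩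
lemma cg.trans (h : cg p r a b) (h' : cg p r b c) : cg p r a c := by
  obtain ⟨z, hz, h⟩ := h
  obtain ⟨w, hw, h'⟩ := h'
  exact ⟨z+w, add_mem hz hw, by linear_combination h + h'⟩
lemma cg.add (h : cg p r a b) (h' : cg p r c d) : cg p r (a+c) (b+d) := by
  obtain ⟨z, hz, h⟩ := h
  obtain ⟨w, hw, h'⟩ := h'
  exact ⟨z+w, add_mem hz hw, by linear_combination h + h'⟩
lemma cg.sub (h : cg p r a b) (h' : cg p r c d) : cg p r (a-c) (b-d) := by
  obtain ⟨z, hz, h⟩ := h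
  obtain ⟨w, hw, h'⟩ := h'
  exact ⟨z-w, sub_mem hz hw, by linear_combination h - h'⟩
lemma cg.mul_left (hc : c ∈ OO p) (h : cg p r a b) : cg p r (c*a) (c*b) := by
  obtain ⟨z, hz, h⟩ := h
  exact ⟨c*z, mul_mem hc hz, by linear_combination c*h⟩
lemma cg.mul_right (hc : c ∈ OO p) (h : cg p r a b) : cg p r (a*c) (b*c) := by
  rw [mul_comm a, mul_comm b]; exact h.mul_left hc
lemma cg.mul (h : cg p r a b) (h' : cg p r c d) (hb : b ∈ OO p) (hc : c ∈ OO p) :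
    cg p r (a*c) (b*d) := (h.mul_right hc).trans (h'.mul_left hb)
lemma cg.mem_left (h : cg p r a b) (hb : b ∈ OO p) : a ∈ OO p := by
  obtain ⟨z, hz, h⟩ := h
  have : a = b + (p:ℚ)^r * z := by linear_combination h
  rw [this]
  exact add_mem hb (mul_mem (pow_mem (natCast_mem _ _) _) hz)
lemma cg.mul' (h : cg p r a b) (h' : cg p r c d) (hb : b ∈ OO p) (hd : d ∈ OO p) :
    cg p r (a*c) (b*d) := h.mul h' hb (h'.mem_left hd)
lemma cg.pow (n : ℕ) (h : cg p r a b) (hb : b ∈ OO p) : cg p r (a^n) (b^n) := by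
  induction n with
  | zero => simpa using cg.refl 1
  | succ n ih => rw [pow_succ, pow_succ]; exact ih.mul' h (pow_mem hb _) hb
lemma cg.sum {ι : Type*} {s : Finset ι} {f g : ι → ℚ} (h : ∀ i ∈ s, cg p r (f i) (g i)) :
    cg p r (∑ i ∈ s, f i) (∑ i ∈ s, g i) := by
  classical
  induction s using Finset.induction_on with
  | empty => simpa using cg.refl 0
  | insert i s hi ih =>
    rw [sum_insert hi, sum_insert hi]
    exact (h i (by simp)).add (ih fun j hj => h j (by simp [hj]))
lemma cg.prod {ι : Type*} {s : Finset ι} {f g : ι → ℚ} (h : ∀ i ∈ s, cg p r (f i) (g i))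
    (hg : ∀ i ∈ s, g i ∈ OO p) :
    cg p r (∏ i ∈ s, f i) (∏ i ∈ s, g i) := by
  classical
  induction s using Finset.induction_on with
  | empty => simpa using cg.refl 1
  | insert i s hi ih =>
    rw [prod_insert hi, prod_insert hi]
    exact (h i (by simp)).mul' (ih (fun j hj => h j (by simp [hj])) fun j hj => hg j (by simp [hj]))
      (hg i (by simp)) (prod_mem fun j hj => hg j (by simp [hj]))
lemma cg.mono {s : ℕ} (h : cg p r a b) (hs : s ≤ r) : cg p s a b := by
  obtain ⟨z, hz, h⟩ := h
  refine ⟨(p:ℚ)^(r-s) * z, mul_mem (pow_mem (natCast_mem _ _) _) hz, ?_⟩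
  rw [h, ← mul_assoc, ← pow_add]
  congr 3; omega
lemma cg.p_mul (k : ℕ) (h : cg p r a b) : cg p (k+r) ((p:ℚ)^k*a) ((p:ℚ)^k*b) := by
  obtain ⟨z, hz, h⟩ := h
  exact ⟨z, hz, by rw [← mul_sub, h, pow_add, mul_assoc]⟩
lemma cg.cancel {u : ℚ} (hu : u⁻¹ ∈ OO p) (hu0 : u ≠ 0) (h : cg p r (u*a) (u*b)) : cg p r a b := by
  have := h.mul_left hu
  rwa [inv_mul_cancel_left₀ hu0, inv_mul_cancel_left₀ hu0] at this
lemma cg.of_dvd {x y : ℤ} (h : (p:ℤ)^r ∣ x - y) : cg p r (x:ℚ) (y:ℚ) := by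
  obtain ⟨z, hz⟩ := h
  exact ⟨z, intCast_mem _ _, by exact_mod_cast hz⟩
lemma cg.num_dvd (h : cg p r a b) : (p:ℤ)^r ∣ (a-b).num := by
  obtain ⟨z, ⟨e, f, hf, hz⟩, h⟩ := h
  have h1 : (a-b) * f = (p:ℚ)^r * e := by rw [h, ← hz]; ring
  have h2 : ((a-b).num : ℚ) * f = (p:ℚ)^r * e * (a-b).den := by
    rw [← h1]
    conv_lhs => rw [← Rat.mul_den_eq_num]
    ring
  have h3 : (a-b).num * f = (p:ℤ)^r * e * (a-b).den := by exact_mod_cast h2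
  have h4 : (p:ℤ)^r ∣ (a-b).num * f := ⟨e * (a-b).den, by rw [h3]; ring⟩
  refine IsCoprime.dvd_of_dvd_mul_right ?_ h4
  apply IsCoprime.pow_left
  exact (Int.prime_iff_natAbs_prime.mpr (by simpa using hp.out)).coprime_iff_not_dvd.mpr hf

lemma p_mem : (p:ℚ) ∈ OO p := natCast_mem _ _

lemma prod_expand2 {k : ℕ} {x v : ℕ → ℚ} (hx : ∀ i < k, cg p 1 (x i) (v i)) (hv : ∀ i < k, v i ∈ OO p) :
    cg p 3 (∏ i ∈ range k, (1 + (p:ℚ)^2 * x i)) (1 + (p:ℚ)^2 * ∑ i ∈ range k, v i) := by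
  induction k with
  | zero => simpa using cg.refl 1
  | succ k ih =>
    rw [prod_range_succ, sum_range_succ]
    have hs : ∑ i ∈ range k, v i ∈ OO p := sum_mem fun i hi => hv i (by simp at hi; omega)
    have h1 : cg p 3 (1 + (p:ℚ)^2 * x k) (1 + (p:ℚ)^2 * v k) :=
      (cg.refl 1).add ((hx k (by omega)).p_mul 2)
    have h2 := (ih (fun i hi => hx i (by omega)) (fun i hi => hv i (by omega))).mul' h1
      (add_mem (one_mem _) (mul_mem (pow_mem p_mem _) hs))
      (add_mem (one_mem _) (mul_mem (pow_mem p_mem _) (hv k (by omega))))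
    refine h2.trans ⟨p * (∑ i ∈ range k, v i) * v k, mul_mem (mul_mem p_mem hs) (hv k (by omega)), by ring⟩

lemma prod_expand1 (h2 : (2:ℚ)⁻¹ ∈ OO p) {k : ℕ} {x : ℕ → ℚ} (hx : ∀ i < k, x i ∈ OO p) :
    cg p 3 (∏ i ∈ range k, (1 + (p:ℚ) * x i))
      (1 + (p:ℚ) * (∑ i ∈ range k, x i) +
        (p:ℚ)^2 * (((∑ i ∈ range k, x i)^2 - ∑ i ∈ range k, (x i)^2) * 2⁻¹)) := by
  induction k with
  | zero => simpa using cg.refl 1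
  | succ k ih =>
    rw [prod_range_succ, sum_range_succ, sum_range_succ]
    have hs : ∑ i ∈ range k, x i ∈ OO p := sum_mem fun i hi => hx i (by simp at hi; omega)
    have hs2 : ∑ i ∈ range k, (x i)^2 ∈ OO p :=
      sum_mem fun i hi => pow_mem (hx i (by simp at hi; omega)) _
    have h3 := (ih (fun i hi => hx i (by omega))).mul_right (c := 1 + (p:ℚ) * x k)
      (add_mem (one_mem _) (mul_mem p_mem (hx k (by omega))))
    refine h3.trans ⟨(((∑ i ∈ range k, x i)^2 - ∑ i ∈ range k, (x i)^2) * 2⁻¹) * x k, 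
      mul_mem (mul_mem (sub_mem (pow_mem hs _) hs2) h2) (hx k (by omega)), by ring⟩

end

/-! ### The two hypergeometric congruences -/

/-- `C(2k,k)/4^k`. -/
def bb (k : ℕ) : ℚ := ∏ i ∈ range k, (((i:ℚ)+1/2)/(i+1))
/-- Harmonic numbers of order two. -/
def h2 (k : ℕ) : ℚ := ∑ i ∈ range k, (((i:ℚ)+1)⁻¹)^2
/-- Odd harmonic numbers of order two. -/
def o2 (k : ℕ) : ℚ := ∑ i ∈ range k, ((2*(i:ℚ)+1)⁻¹)^2

lemma bb_succ (k : ℕ) : bb (k+1) = bb k * (((k:ℚ)+1/2)/(k+1)) := prod_range_succ _ _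
lemma h2_succ (k : ℕ) : h2 (k+1) = h2 k + (((k:ℚ)+1)⁻¹)^2 := sum_range_succ _ _
lemma o2_succ (k : ℕ) : o2 (k+1) = o2 k + ((2*(k:ℚ)+1)⁻¹)^2 := sum_range_succ _ _

lemma bb_eq (k : ℕ) : bb k = ((2*k).choose k : ℚ) / 4^k := by
  induction k with
  | zero => simp [bb]
  | succ k ih =>
    have h := Nat.succ_mul_centralBinom_succ k
    rw [Nat.centralBinom_eq_two_mul_choose, Nat.centralBinom_eq_two_mul_choose] at h
    have h' : ((k:ℚ)+1) * ((2*(k+1)).choose (k+1) : ℚ) = 2*(2*k+1) * ((2*k).choose k : ℚ) := by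
      exact_mod_cast h
    have h3 : ((2*(k+1)).choose (k+1) : ℚ) = 2*(2*k+1) * ((2*k).choose k : ℚ) / (k+1) := by
      rw [eq_div_iff (by positivity)]; linarith
    rw [bb_succ, ih, h3]
    field_simp
    ring

lemma h2_two_mul (k : ℕ) : h2 (2*k) = o2 k + h2 k / 4 := by
  induction k with
  | zero => simp [h2, o2]
  | succ k ih =>
    rw [show 2*(k+1) = 2*k+1+1 by ring, h2_succ, h2_succ, ih, o2_succ, h2_succ]
    push_cast
    field_simp
    ring

section
variable {p : ℕ} [hp : Fact p.Prime]

lemma nat_unit {b : ℕ} (h0 : 0 < b) (h1 : b < p) : (b:ℚ)⁻¹ ∈ OO p :=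
  OO_nat_inv (Nat.not_dvd_of_pos_of_lt h0 h1)

lemma cg.inv {r : ℕ} {x y : ℚ} (h : cg p r x y) (hx : x⁻¹ ∈ OO p) (hy : y⁻¹ ∈ OO p) (hx0 : x ≠ 0)
    (hy0 : y ≠ 0) : cg p r x⁻¹ y⁻¹ := by
  obtain ⟨z, hz, h⟩ := h
  refine ⟨-z * x⁻¹ * y⁻¹, mul_mem (mul_mem (neg_mem hz) hx) hy, ?_⟩
  field_simp
  linear_combination -h

/-- `x + y = p` gives the same inverse square mod `p`. -/
lemma cg_inv_sq {x y : ℚ} (h : x + y = p) (hx : x⁻¹ ∈ OO p) (hy : y⁻¹ ∈ OO p) (hx0 : x ≠ 0)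
    (hy0 : y ≠ 0) : cg p 1 (x⁻¹^2) (y⁻¹^2) := by
  have h1 : cg p 1 x (-y) := ⟨1, one_mem _, by linear_combination h⟩
  have h2 := (h1.inv hx (by rw [inv_neg]; exact neg_mem hy) hx0 (neg_ne_zero.mpr hy0)).pow 2
    (by rw [inv_neg]; exact neg_mem hy)
  rwa [inv_neg, neg_sq] at h2

variable {m : ℕ}

lemma m_pos (hpm : p = 4*m+1) : 0 < m := by
  rcases Nat.eq_zero_or_pos m with h | h
  · subst h; exact absurd hp.out (by rw [hpm]; norm_num)
  · exact h

lemma inv2 (hpm : p = 4*m+1) : (2:ℚ)⁻¹ ∈ OO p := by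
  have := m_pos hpm
  exact_mod_cast nat_unit (p := p) (b := 2) (by norm_num) (by omega)

lemma inv3 (hpm : p = 4*m+1) : (3:ℚ)⁻¹ ∈ OO p := by
  have := m_pos hpm
  exact_mod_cast nat_unit (p := p) (b := 3) (by norm_num) (by omega)

lemma inv4 (hpm : p = 4*m+1) : (4:ℚ)⁻¹ ∈ OO p := by
  have := m_pos hpm
  exact_mod_cast nat_unit (p := p) (b := 4) (by norm_num) (by omega)

lemma inv_succ (hpm : p = 4*m+1) {i : ℕ} (hi : i < 4*m) : ((i:ℚ)+1)⁻¹ ∈ OO p := by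
  exact_mod_cast nat_unit (p := p) (b := i+1) (by omega) (by omega)

lemma inv_odd (hpm : p = 4*m+1) {i : ℕ} (hi : i < 2*m) : (2*(i:ℚ)+1)⁻¹ ∈ OO p := by
  exact_mod_cast nat_unit (p := p) (b := 2*i+1) (by omega) (by omega)

lemma h2_mem (hpm : p = 4*m+1) {k : ℕ} (hk : k ≤ 4*m) : h2 k ∈ OO p :=
  sum_mem fun i hi => pow_mem (inv_succ hpm (by simp at hi; omega)) _

lemma o2_mem (hpm : p = 4*m+1) {k : ℕ} (hk : k ≤ 2*m) : o2 k ∈ OO p :=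
  sum_mem fun i hi => pow_mem (inv_odd hpm (by simp at hi; omega)) _

lemma bb_mem (hpm : p = 4*m+1) {k : ℕ} (hk : k ≤ 4*m) : bb k ∈ OO p :=
  prod_mem fun i hi => by
    rw [div_eq_mul_inv, one_div]
    exact mul_mem (add_mem (natCast_mem _ _) (inv2 hpm)) (inv_succ hpm (by simp at hi; omega))

lemma o2_cg (hpm : p = 4*m+1) {k : ℕ} (hk : k ≤ 2*m) : cg p 1 (4 * o2 k + h2 (2*m-k)) (h2 (2*m)) := by
  induction k with
  | zero => simpa [o2] using cg.refl _
  | succ k ih =>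
    have ih := ih (by omega)
    have e : 2*m - k = (2*m-(k+1))+1 := by omega
    rw [e, h2_succ] at ih
    rw [o2_succ]
    have hc : ((2*m-(k+1) : ℕ):ℚ) = 2*m-(k+1) := by rw [Nat.cast_sub hk]; push_cast; ring
    have hne : ((2*m-(k+1) : ℕ):ℚ) + 1 ≠ 0 := by positivity
    have hpq : (p:ℚ) = 4*m+1 := by rw [hpm]; push_cast; ring
    have h1 := cg_inv_sq (p := p) (x := 2*(k:ℚ)+1) (y := 2*(((2*m-(k+1) : ℕ):ℚ) + 1))
      (by rw [hpq, hc]; ring) (inv_odd hpm (by omega))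
      (by rw [mul_inv]; exact mul_mem (inv2 hpm) (inv_succ hpm (by omega))) (by positivity) (by positivity)
    have h2 := h1.mul_left (c := 4) (by exact_mod_cast natCast_mem (OO p) 4)
    have e2 : 4 * ((2*(((2*m-(k+1) : ℕ):ℚ) + 1))⁻¹)^2 = ((((2*m-(k+1) : ℕ):ℚ) + 1)⁻¹)^2 := by
      field_simp; norm_num
    rw [e2] at h2
    have h3 := (ih.add h2).sub (cg.refl (p := p) (r := 1) (((((2*m-(k+1) : ℕ):ℚ) + 1)⁻¹)^2))
    refine (cg.of_eq ?_).trans (h3.trans (cg.of_eq ?_)) <;> ring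

lemma h2_refl (hpm : p = 4*m+1) {k : ℕ} (hk : k ≤ 2*m) : cg p 1 (h2 (2*m+k) + h2 (2*m-k)) (2*h2 (2*m)) := by
  induction k with
  | zero => exact cg.of_eq (by simp; ring)
  | succ k ih =>
    have ih := ih (by omega)
    have e : 2*m - k = (2*m-(k+1))+1 := by omega
    rw [e, h2_succ] at ih
    rw [← add_assoc, h2_succ]
    have hc : ((2*m-(k+1) : ℕ):ℚ) = 2*m-(k+1) := by rw [Nat.cast_sub hk]; push_cast; ring
    have hpq : (p:ℚ) = 4*m+1 := by rw [hpm]; push_cast; ring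
    have h1 := cg_inv_sq (p := p) (x := ((2*m+k:ℕ):ℚ)+1) (y := (((2*m-(k+1) : ℕ):ℚ) + 1))
      (by rw [hpq, hc]; push_cast; ring) (inv_succ hpm (by omega))
      (inv_succ hpm (by omega)) (by positivity) (by positivity)
    have h3 := (ih.add h1).sub (cg.refl (p := p) (r := 1) (((((2*m-(k+1) : ℕ):ℚ) + 1)⁻¹)^2))
    refine (cg.of_eq ?_).trans (h3.trans (cg.of_eq ?_)) <;> ring

lemma h2_zero (hpm : p = 4*m+1) : cg p 1 (h2 (2*m)) 0 := by
  have a1 := o2_cg hpm (le_refl (2*m))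
  have a2 := h2_refl hpm (le_refl (2*m))
  have a3 := h2_two_mul (2*m)
  rw [show 2*m+2*m = 2*(2*m) by ring, a3] at a2
  simp only [Nat.sub_self] at a1 a2
  have e0 : h2 0 = 0 := by simp [h2]
  rw [e0] at a1 a2
  have a4 := a2.mul_left (c := 4) (by exact_mod_cast natCast_mem (OO p) 4)
  have a5 := (a4.sub a1).mul_left (inv2 hpm)
  apply cg.cancel (u := 3) (inv3 hpm) (by norm_num)
  have a6 := a5.symm.sub (cg.refl (p := p) (r := 1) (2⁻¹ * h2 (2*m)))
  refine (cg.of_eq ?_).trans (a6.trans (cg.of_eq ?_)) <;> ring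

lemma o2_cg' (hpm : p = 4*m+1) {k : ℕ} (hk : k ≤ 2*m) : cg p 1 (4 * o2 k) (- h2 (2*m-k)) := by
  have := ((o2_cg hpm hk).trans (h2_zero hpm)).sub (cg.refl (p := p) (r := 1) (h2 (2*m-k)))
  refine (cg.of_eq ?_).trans (this.trans (cg.of_eq ?_)) <;> ring

lemma bb_cg (hpm : p = 4*m+1) {k : ℕ} (hk : k ≤ 2*m) : cg p 1 (bb k) ((-1)^k * ((2*m).choose k : ℚ)) := by
  induction k with
  | zero => simpa [bb] using cg.refl 1
  | succ k ih =>
    have ih := ih (by omega)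
    rw [bb_succ]
    have h1 := Nat.choose_succ_right_eq (2*m) k
    have h1' : ((2*m).choose (k+1) : ℚ) * (k+1) = (2*m).choose k * (2*m-k) := by
      have : ((2*m-k : ℕ):ℚ) = 2*m-k := by rw [Nat.cast_sub (by omega)]; push_cast; ring
      rw [← this]; exact_mod_cast h1
    have hpq : (p:ℚ) = 4*m+1 := by rw [hpm]; push_cast; ring
    have h2 : cg p 1 ((k:ℚ)+1/2) (-(2*m-k)) := ⟨2⁻¹, inv2 hpm, by rw [hpq]; ring⟩
    have hm : (-(2*m-k) : ℚ) ∈ OO p := by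
      have := intCast_mem (OO p) (-(2*m-k) : ℤ)
      push_cast at this
      exact this
    have hch : (-1:ℚ)^k * ((2*m).choose k : ℚ) ∈ OO p :=
      mul_mem (pow_mem (neg_mem (one_mem _)) _) (natCast_mem _ _)
    have h3 := (ih.mul' h2 hch hm).mul_right (inv_succ hpm (i := k) (by omega))
    refine (cg.of_eq ?_).trans (h3.trans (cg.of_eq ?_))
    · ring
    · rw [mul_inv_eq_iff_eq_mul₀ (by positivity)]
      rw [pow_succ]
      linear_combination (-1)^k * h1'

lemma bb_symm (hpm : p = 4*m+1) {k : ℕ} (hk : k ≤ 2*m) : cg p 1 (bb (2*m-k)) (bb k) := by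
  have h1 := bb_cg hpm (k := 2*m-k) (by omega)
  rw [Nat.choose_symm hk] at h1
  have e : (-1:ℚ)^(2*m-k) = (-1)^k := by
    have : (-1:ℚ)^(2*m-k) * (-1)^k = 1 := by
      rw [← pow_add, Nat.sub_add_cancel hk, pow_mul]; simp
    rcases neg_one_pow_eq_or ℚ k with h | h <;> rw [h] at this ⊢ <;> linarith
  rw [e] at h1
  exact h1.trans (bb_cg hpm hk).symm

lemma sum_zero1 (hpm : p = 4*m+1) : cg p 1 (∑ k ∈ range (2*m+1), bb k ^ 3 * (o2 k + h2 k / 4)) 0 := by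
  have h1 : cg p 1 (∑ k ∈ range (2*m+1), bb k ^ 3 * (o2 k + h2 k / 4))
      (∑ k ∈ range (2*m+1), (bb k ^ 3 * (h2 k * 4⁻¹) - bb (2*m-k) ^ 3 * (h2 (2*m-k) * 4⁻¹))) := by
    apply cg.sum
    intro k hk
    have hk : k ≤ 2*m := by simp at hk; omega
    have a1 := (o2_cg' hpm hk).mul_right (inv4 hpm)
    have a2 := ((bb_symm hpm hk).symm.pow 3 (bb_mem hpm (by omega))).mul' a1
      (pow_mem (bb_mem hpm (by omega)) _) (mul_mem (neg_mem (h2_mem hpm (by omega))) (inv4 hpm))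
    have a3 := a2.add (cg.refl (p := p) (r := 1) (bb k ^ 3 * (h2 k * 4⁻¹)))
    refine (cg.of_eq ?_).trans (a3.trans (cg.of_eq ?_)) <;> ring
  refine h1.trans (cg.of_eq ?_)
  rw [sum_sub_distrib]
  have := sum_range_reflect (fun k => bb k ^ 3 * (h2 k * 4⁻¹)) (2*m+1)
  simp only [Nat.add_sub_cancel] at this
  rw [this, sub_self]

lemma sum_zero2 (hpm : p = 4*m+1) : cg p 1 (∑ k ∈ range (2*m+1), (4*(k:ℚ)+1) * (bb k ^ 3 * (o2 k - h2 k / 4))) 0 := by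
  have h1 : cg p 1 (∑ k ∈ range (2*m+1), (4*(k:ℚ)+1) * (bb k ^ 3 * (o2 k - h2 k / 4)))
      (∑ k ∈ range (2*m+1), (-((4*(k:ℚ)+1) * (bb k ^ 3 * (h2 k * 4⁻¹)))
        + ((4*((2*m-k:ℕ):ℚ)+1) * (bb (2*m-k) ^ 3 * (h2 (2*m-k) * 4⁻¹))))) := by
    apply cg.sum
    intro k hk
    have hk : k ≤ 2*m := by simp at hk; omega
    have a1 := (o2_cg' hpm hk).mul_right (inv4 hpm)
    have a2 := ((bb_symm hpm hk).symm.pow 3 (bb_mem hpm (by omega))).mul' a1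
      (pow_mem (bb_mem hpm (by omega)) _) (mul_mem (neg_mem (h2_mem hpm (by omega))) (inv4 hpm))
    have hpq : (p:ℚ) = 4*m+1 := by rw [hpm]; push_cast; ring
    have a0 : cg p 1 (4*(k:ℚ)+1) (-(4*((2*m-k:ℕ):ℚ)+1)) := by
      refine ⟨2, by exact_mod_cast natCast_mem (OO p) 2, ?_⟩
      rw [hpq, Nat.cast_sub hk]; push_cast; ring
    have a5 := a0.mul' a2 (neg_mem (by exact_mod_cast natCast_mem (OO p) (4*(2*m-k)+1)))
      (mul_mem (pow_mem (bb_mem hpm (by omega)) _) (mul_mem (neg_mem (h2_mem hpm (by omega))) (inv4 hpm)))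
    have a3 := a5.sub (cg.refl (p := p) (r := 1) ((4*(k:ℚ)+1) * (bb k ^ 3 * (h2 k * 4⁻¹))))
    refine (cg.of_eq ?_).trans (a3.trans (cg.of_eq ?_)) <;> ring
  refine h1.trans (cg.of_eq ?_)
  rw [sum_add_distrib]
  have := sum_range_reflect (fun k:ℕ => (4*(k:ℚ)+1) * (bb k ^ 3 * (h2 k * 4⁻¹))) (2*m+1)
  simp only [Nat.add_sub_cancel] at this
  rw [this, sum_neg_distrib]; ring

lemma term_cg (hpm : p = 4*m+1) (σ : ℤ) (hσ : ∀ i : ℕ, (1 + σ * (p:ℚ)^2 / (4*((i:ℚ)+1)^2)) ≠ 0) {k : ℕ} (hk : k ≤ 2*m) :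
    cg p 3 (∏ i ∈ range k, ((((i:ℚ)+1/2)/(i+1))^3 * ((1 - (p:ℚ)^2/(2*i+1)^2) /
      (1 + σ * (p:ℚ)^2 / (4*((i:ℚ)+1)^2))))) (bb k ^ 3 * (1 - (p:ℚ)^2 * (o2 k + σ * (h2 k / 4)))) := by
  rw [prod_mul_distrib, prod_pow]
  change cg p 3 (bb k ^ 3 * _) _
  apply cg.mul_left (pow_mem (bb_mem hpm (by omega)) _)
  set v : ℕ → ℚ := fun i => -(((2*(i:ℚ)+1)⁻¹)^2 + σ * ((((i:ℚ)+1)⁻¹)^2 * 4⁻¹)) with hv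
  have hvm : ∀ i < k, v i ∈ OO p := fun i hi => neg_mem (add_mem (pow_mem (inv_odd hpm (by omega)) _)
    (mul_mem (intCast_mem _ _) (mul_mem (pow_mem (inv_succ hpm (by omega)) _) (inv4 hpm))))
  have hu : ∀ i < k, (1 + σ * (p:ℚ)^2 / (4*((i:ℚ)+1)^2))⁻¹ ∈ OO p := by
    intro i hi
    have : (1 + σ * (p:ℚ)^2 / (4*((i:ℚ)+1)^2))⁻¹ = 4 * (((i:ℚ)+1)^2) * ((4*((i:ℤ)+1)^2 + σ * (p:ℤ)^2 : ℤ):ℚ)⁻¹ := by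
      have h := hσ i
      have e : (1 + σ * (p:ℚ)^2 / (4*((i:ℚ)+1)^2)) = (((4*((i:ℤ)+1)^2 + σ * (p:ℤ)^2 : ℤ)):ℚ) / (4*((i:ℚ)+1)^2) := by
        push_cast; field_simp
      rw [e, inv_div, div_eq_mul_inv]
    rw [this]
    refine mul_mem (by exact_mod_cast natCast_mem (OO p) (4*(i+1)^2)) (OO_int_inv ?_)
    intro hd
    have hd2 : (p:ℤ) ∣ (4*((i:ℤ)+1)^2) := by
      have : (p:ℤ) ∣ σ * (p:ℤ)^2 := Dvd.intro_left (σ * p) (by ring)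
      exact (Int.dvd_add_left this).mp hd
    have hd3 : p ∣ 4*(i+1)^2 := by exact_mod_cast hd2
    rcases hp.out.dvd_mul.mp hd3 with h | h
    · have := Nat.le_of_dvd (by norm_num) h
      have := m_pos hpm
      omega
    · have := Nat.le_of_dvd (by omega) (hp.out.dvd_of_dvd_pow h)
      omega
  have key := prod_expand2 (p := p) (k := k)
    (x := fun i => v i * (1 + σ * (p:ℚ)^2 / (4*((i:ℚ)+1)^2))⁻¹) (v := v) (by
      intro i hi
      refine ⟨-(v i * (σ * p * ((((i:ℚ)+1)⁻¹)^2 * 4⁻¹)) * (1 + σ * (p:ℚ)^2 / (4*((i:ℚ)+1)^2))⁻¹), ?_, ?_⟩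
      · exact neg_mem (mul_mem (mul_mem (hvm i hi) (mul_mem (mul_mem (intCast_mem _ _) p_mem)
          (mul_mem (pow_mem (inv_succ hpm (by omega)) _) (inv4 hpm)))) (hu i hi))
      · have h := hσ i
        have e : σ * (p:ℚ)^2 / (4*((i:ℚ)+1)^2) = p * (σ * p * ((((i:ℚ)+1)⁻¹)^2 * 4⁻¹)) := by
          field_simp
        rw [e] at h ⊢
        generalize (σ * p * ((((i:ℚ)+1)⁻¹)^2 * 4⁻¹)) = w at *
        generalize v i = vv
        field_simp
        ring) hvm
  refine (cg.of_eq ?_).trans (key.trans (cg.of_eq ?_))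
  · apply prod_congr rfl
    intro i hi
    have h := hσ i
    rw [div_eq_iff h, add_mul, one_mul, mul_assoc, mul_assoc, inv_mul_cancel₀ h, hv]
    field_simp
    ring
  · rw [hv, sum_neg_distrib, sum_add_distrib, ← mul_sum, ← sum_mul]
    change 1 + (p:ℚ)^2 * -(o2 k + σ * (h2 k * 4⁻¹)) = _
    ring

/-- The first congruence. -/
lemma S0_cg (hpm : p = 4*m+1) : cg p 3 (∑ k ∈ range (2*m+1), bb k ^ 3)
    (∏ i ∈ range m, (((2*i+1:ℚ)^2 + (p:ℚ)^2/4) / ((2*i+2:ℚ)^2 + (p:ℚ)^2/4))) := by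
  have hpq : (p:ℚ) = 4*m+1 := by rw [hpm]; push_cast; ring
  have w := whipple (-(p:ℚ)^2/4) (by intro i; have : 0 < ((i:ℚ)+1)^2 + p^2/4 := by positivity
                                     intro h; linarith) m
  have hr : ∏ i ∈ range m, (((2*i+1:ℚ)^2 + (p:ℚ)^2/4) / ((2*i+2:ℚ)^2 + (p:ℚ)^2/4)) = 
    ∏ i ∈ range m, (((2*i+1:ℚ)^2 - -(p:ℚ)^2/4) / ((2*i+2:ℚ)^2 - -(p:ℚ)^2/4)) := by
    apply prod_congr rfl; intro i _; congr 1 <;> ring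
  rw [hr, ← w]
  have h1 : cg p 3 (∑ k ∈ range (2*m+1), ∏ i ∈ range k,
        (((i:ℚ) - (2*m:ℕ)) * ((2*m:ℕ)+1+i) * ((i+1/2) / ((i+1) * ((i+1)^2 - -(p:ℚ)^2/4)))))
      (∑ k ∈ range (2*m+1), (bb k ^ 3 * (1 - (p:ℚ)^2 * (o2 k + (1:ℤ) * (h2 k / 4))))) := by
    apply cg.sum
    intro k hk
    refine (cg.of_eq ?_).trans (term_cg hpm 1 (by intro i; positivity) (by simp at hk; omega))
    apply prod_congr rfl
    intro i _
    have e1 : ((i:ℚ) - (2*m:ℕ)) * ((2*m:ℕ)+1+i) = (i+1/2)^2 - p^2/4 := by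
      rw [hpq]; push_cast; ring
    have e2 : ((i:ℚ)+1)^2 - -(p:ℚ)^2/4 = (4*((i:ℚ)+1)^2 + p^2)/4 := by ring
    rw [e1, e2]
    have : 4*((i:ℚ)+1)^2 + p^2 ≠ 0 := by positivity
    push_cast
    field_simp
    ring
  refine cg.symm (h1.trans ?_)
  have h2 := (sum_zero1 hpm).p_mul 2
  have h3 := (cg.refl (p := p) (r := 3) (∑ k ∈ range (2*m+1), bb k ^ 3)).sub h2
  refine (cg.of_eq ?_).trans (h3.trans (cg.of_eq (by ring)))
  rw [mul_sum, ← sum_sub_distrib]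
  apply sum_congr rfl; intro k _; push_cast; ring

/-- The second congruence. -/
lemma T_cg (hpm : p = 4*m+1) : cg p 3 (∑ k ∈ range (2*m+1), (4*(k:ℚ)+1) * bb k ^ 3)
    (p * ∏ i ∈ range (2*m), ((4*(i:ℚ)+5)/(4*i+3))) := by
  have hpq : (p:ℚ) = 4*m+1 := by rw [hpm]; push_cast; ring
  have w := dougall (2*m)
  have hne : ∀ i : ℕ, (4*((i:ℚ)+1)^2 - p^2) ≠ 0 := by
    intro i h
    have h' : (2*((i:ℚ)+1) - p) * (2*((i:ℚ)+1)+p) = 0 := by linear_combination h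
    rcases mul_eq_zero.mp h' with h | h
    · have : (2*((i:ℚ)+1)) = 4*m+1 := by rw [← hpq]; linarith
      have : 2*(i+1) = 4*m+1 := by exact_mod_cast this
      omega
    · have : 0 < (2*((i:ℚ)+1)+p) := by positivity
      linarith
  have hr : (p * ∏ i ∈ range (2*m), ((4*(i:ℚ)+5)/(4*i+3))) = 
     (2*(2*m:ℕ)+1) * ∏ i ∈ range (2*m), ((4*(i:ℚ)+5)/(4*i+3)) := by
    rw [hpq]; push_cast; ring
  rw [hr, ← w]
  have h1 : cg p 3 (∑ k ∈ range (2*m+1), (4*(k:ℚ)+1) * ∏ i ∈ range k,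
        (((i:ℚ)+1/2)/(i+1) * (((i:ℚ)-(2*m:ℕ)) * ((2*m:ℕ)+1+i) / ((i+1/2-(2*m:ℕ)) * ((2*m:ℕ)+3/2+i)))))
      (∑ k ∈ range (2*m+1), (4*(k:ℚ)+1) * (bb k ^ 3 * (1 - (p:ℚ)^2 * (o2 k + (-1:ℤ) * (h2 k / 4))))) := by
    apply cg.sum
    intro k hk
    apply cg.mul_left (by exact_mod_cast natCast_mem (OO p) (4*k+1))
    refine (cg.of_eq ?_).trans (term_cg hpm (-1) (by
      intro i h
      apply hne i
      field_simp at h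
      push_cast at h
      linear_combination h) (by simp at hk; omega))
    apply prod_congr rfl
    intro i _
    have e1 : ((i:ℚ) - (2*m:ℕ)) * ((2*m:ℕ)+1+i) = (i+1/2)^2 - p^2/4 := by
      rw [hpq]; push_cast; ring
    have e2 : ((i:ℚ)+1/2-(2*m:ℕ)) * ((2*m:ℕ)+3/2+i) = (4*((i:ℚ)+1)^2 - p^2)/4 := by
      rw [hpq]; push_cast; ring
    rw [e1, e2]
    have := hne i
    have e3 : (1 + ((-1:ℤ):ℚ) * (p:ℚ)^2 / (4*((i:ℚ)+1)^2)) = (4*((i:ℚ)+1)^2 - p^2) / (4*((i:ℚ)+1)^2) := by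
      push_cast; field_simp; ring
    rw [e3]
    field_simp
    ring
  refine cg.symm (h1.trans ?_)
  have h2 := (sum_zero2 hpm).p_mul 2
  have h3 := (cg.refl (p := p) (r := 3) (∑ k ∈ range (2*m+1), (4*(k:ℚ)+1) * bb k ^ 3)).sub h2
  refine (cg.of_eq ?_).trans (h3.trans (cg.of_eq (by ring)))
  rw [mul_sum, ← sum_sub_distrib]
  apply sum_congr rfl; intro k _; push_cast; ring

lemma trunc (hpm : p = 4*m+1) (w : ℕ → ℚ) (hw : ∀ k, w k ∈ OO p) :
    cg p 3 (∑ k ∈ range p, w k * bb k ^ 3) (∑ k ∈ range (2*m+1), w k * bb k ^ 3) := by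
  rw [← sum_range_add_sum_Ico _ (show 2*m+1 ≤ p by omega)]
  have : cg p 3 (∑ k ∈ Ico (2*m+1) p, w k * bb k ^ 3) (∑ k ∈ Ico (2*m+1) p, 0) := by
    apply cg.sum
    intro k hk
    simp only [mem_Ico] at hk
    have hd : p ∣ (2*k).choose k := by
      rw [two_mul]
      exact hp.out.dvd_choose_add hk.2 hk.2 (by omega)
    obtain ⟨c, hc⟩ := hd
    refine ⟨w k * (c * (4⁻¹)^k)^3, mul_mem (hw k) (pow_mem (mul_mem (natCast_mem _ _) (pow_mem (inv4 hpm) _)) _), ?_⟩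
    rw [bb_eq, hc, div_eq_mul_inv, ← inv_pow]
    push_cast
    ring
  have h2 := (cg.refl (p := p) (r := 3) (∑ k ∈ range (2*m+1), w k * bb k ^ 3)).add this
  simpa using h2

lemma sum_three (hpm : p = 4*m+1) : cg p 3 (∑ k ∈ range p, (12*(k:ℚ)^2+6*k+1) * bb k ^ 3) 0 := by
  have : ∀ N : ℕ, ∑ k ∈ range N, (12*(k:ℚ)^2+6*k+1) * bb k ^ 3 = 8 * N^3 * bb N ^ 3 := by
    intro N
    induction N with
    | zero => simp
    | succ N ih =>
      rw [sum_range_succ, ih, bb_succ]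
      push_cast
      field_simp
      ring
  rw [this]
  refine ⟨8 * bb p ^ 3, mul_mem (by exact_mod_cast natCast_mem (OO p) 8) (pow_mem ?_ _), by ring⟩
  rw [bb_eq, div_eq_mul_inv, ← inv_pow]
  exact mul_mem (natCast_mem _ _) (pow_mem (inv4 hpm) _)

end

/-! ### Expansions modulo `p^3` -/

/-- `∏ (1 + q/i)` for `1 ≤ i ≤ k`. -/
def EE (q : ℚ) (k : ℕ) : ℚ := ∏ i ∈ range k, (1 + q/((i:ℚ)+1))
/-- Harmonic numbers. -/
def h1 (k : ℕ) : ℚ := ∑ i ∈ range k, ((i:ℚ)+1)⁻¹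

lemma EE_succ (q : ℚ) (k : ℕ) : EE q (k+1) = EE q k * (1 + q/((k:ℚ)+1)) := prod_range_succ _ _

lemma fact_EE (Q k : ℕ) : ((Q+k).factorial : ℚ) = Q.factorial * k.factorial * EE Q k := by
  induction k with
  | zero => simp [EE]
  | succ k ih =>
    rw [← add_assoc, Nat.factorial_succ, Nat.factorial_succ, EE_succ]
    push_cast
    rw [ih]
    field_simp
    ring

lemma EE_ne (Q k : ℕ) : EE Q k ≠ 0 := by
  unfold EE
  exact (prod_pos fun i _ => by positivity).ne'

lemma choose_EE (m : ℕ) : ((2*m).choose m : ℚ) = EE m m := by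
  rw [Nat.cast_choose ℚ (by omega : m ≤ 2*m), show 2*m - m = m by omega, two_mul, fact_EE]
  field_simp

lemma choose6 (m p : ℕ) (hpm : p = 4*m+1) : ((6*m).choose m : ℚ) =
    (2*m).choose m * ((5*m+1)/(6*m+1)) * (EE p (2*m) * (EE p m)⁻¹) := by
  have f1 := fact_EE p (2*m)
  have f2 := fact_EE p m
  rw [show p + 2*m = 6*m+1 by omega, Nat.factorial_succ] at f1
  rw [show p + m = 5*m+1 by omega, Nat.factorial_succ] at f2
  rw [Nat.cast_choose ℚ (by omega : m ≤ 6*m), show 6*m - m = 5*m by omega,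
    Nat.cast_choose ℚ (by omega : m ≤ 2*m), show 2*m - m = m by omega]
  have := EE_ne p m
  push_cast at f1 f2
  have g1 : ((6*m).factorial : ℚ) = p.factorial * (2*m).factorial * EE p (2*m) / (6*m+1) := by
    rw [eq_div_iff (by positivity)]; linarith
  have g2 : ((5*m).factorial : ℚ) = p.factorial * m.factorial * EE p m / (5*m+1) := by
    rw [eq_div_iff (by positivity)]; linarith
  rw [g1, g2]
  field_simp

lemma choose10a (m p : ℕ) (hpm : p = 4*m+1) : ((10*m).choose m : ℚ) =
    (2*m).choose m * ((9*m+1)*(9*m+2)/((10*m+1)*(10*m+2))) *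
      (EE (2*p:ℕ) (2*m) * (EE (2*p:ℕ) m)⁻¹) := by
  have f1 := fact_EE (2*p) (2*m)
  have f2 := fact_EE (2*p) m
  rw [show 2*p + 2*m = 10*m+1+1 by omega, Nat.factorial_succ, Nat.factorial_succ] at f1
  rw [show 2*p + m = 9*m+1+1 by omega, Nat.factorial_succ, Nat.factorial_succ] at f2
  rw [Nat.cast_choose ℚ (by omega : m ≤ 10*m), show 10*m - m = 9*m by omega,
    Nat.cast_choose ℚ (by omega : m ≤ 2*m), show 2*m - m = m by omega]
  have := EE_ne (2*p) m
  generalize EE (2*p:ℕ) m = E1 at *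
  generalize EE (2*p:ℕ) (2*m) = E2 at *
  generalize (2*p).factorial = F at *
  have hF : (F:ℚ) ≠ 0 := by
    intro h; rw [h] at f1; simp at f1
    rcases f1 with f1 | f1
    · have : (0:ℚ) < 10*m+1+1 := by positivity
      linarith
    · rcases f1 with f1 | f1
      · have : (0:ℚ) < 10*m+1 := by positivity
        linarith
      · exact absurd f1 (Nat.factorial_ne_zero _)
  push_cast at f1 f2
  have g1 : ((10*m).factorial : ℚ) = F * (2*m).factorial * E2 / ((10*m+1)*(10*m+2)) := by
    rw [eq_div_iff (by positivity)]; linarith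
  have g2 : ((9*m).factorial : ℚ) = F * m.factorial * E1 / ((9*m+1)*(9*m+2)) := by
    rw [eq_div_iff (by positivity)]; linarith
  rw [g1, g2]
  field_simp

lemma choose10b (m p : ℕ) (hpm : p = 4*m+1) : ((10*m).choose (5*m) : ℚ) =
    (2*m).choose m * EE p p * ((5*m+1)^2/((10*m+1)*(10*m+2))) *
      (EE (2*p:ℕ) (2*m) * ((EE p m)⁻¹)^2) := by
  have f0 := fact_EE p p
  have f1 := fact_EE (2*p) (2*m)
  have f2 := fact_EE p m
  rw [show 2*p + 2*m = 10*m+1+1 by omega, Nat.factorial_succ, Nat.factorial_succ] at f1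
  rw [show p + m = 5*m+1 by omega, Nat.factorial_succ] at f2
  rw [show p + p = 2*p by omega] at f0
  rw [Nat.cast_choose ℚ (by omega : 5*m ≤ 10*m), show 10*m - 5*m = 5*m by omega,
    Nat.cast_choose ℚ (by omega : m ≤ 2*m), show 2*m - m = m by omega]
  have := EE_ne p m
  generalize EE p m = E1 at *
  generalize EE (2*p:ℕ) (2*m) = E2 at *
  generalize EE p p = E3 at *
  rw [f0] at f1
  push_cast at f1 f2
  have g1 : ((10*m).factorial : ℚ) = p.factorial * p.factorial * E3 * (2*m).factorial * E2 / ((10*m+1)*(10*m+2)) := by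
    rw [eq_div_iff (by positivity)]; linarith
  have g2 : ((5*m).factorial : ℚ) = p.factorial * m.factorial * E1 / (5*m+1) := by
    rw [eq_div_iff (by positivity)]; linarith
  rw [g1, g2]
  field_simp

lemma bb_EE (m p : ℕ) (hpm : p = 4*m+1) (hne : EE (-p/2) m ≠ 0) :
    bb m = (-1)^m * (2*m).choose m * (EE (-p/2) (2*m) * (EE (-p/2) m)⁻¹) := by
  have hpq : (p:ℚ) = 4*m+1 := by rw [hpm]; push_cast; ring
  have e1 : EE (-p/2) (2*m) = EE (-p/2) m * ∏ i ∈ range m, (1 + (-p/2)/((m+i:ℕ)+1:ℚ)) := by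
    rw [two_mul]; exact prod_range_add _ _ _
  have e2 : EE (-p/2) (2*m) * (EE (-p/2) m)⁻¹ = ∏ i ∈ range m, (1 + (-p/2)/((m+i:ℕ)+1:ℚ)) := by
    rw [e1, mul_comm, inv_mul_cancel_left₀ hne]
  rw [e2, choose_EE, EE, mul_assoc, ← prod_mul_distrib]
  unfold bb
  rw [prod_div_distrib, ← prod_range_reflect, ← prod_div_distrib]
  have : (-1:ℚ)^m = ∏ i ∈ range m, (-1) := by simp
  rw [this, ← prod_mul_distrib, prod_div_distrib, ← prod_div_distrib]
  apply prod_congr rfl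
  intro i hi
  simp only [mem_range] at hi
  rw [show m - 1 - i = m - (i+1) by omega, Nat.cast_sub (by omega), hpq]
  push_cast
  field_simp
  ring

section
variable {p : ℕ} [hp : Fact p.Prime]

/-- `x ≡ a + b p + c p²` modulo `p³`. -/
def Ser (p : ℕ) [Fact p.Prime] (x a b c : ℚ) : Prop :=
  a ∈ OO p ∧ b ∈ OO p ∧ c ∈ OO p ∧ cg p 3 x (a + b * p + c * p^2)

variable {x y a b c a' b' c' : ℚ}

lemma Ser.mem (h : Ser p x a b c) : x ∈ OO p := by
  obtain ⟨h1, h2, h3, h4⟩ := h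
  exact h4.mem_left (add_mem (add_mem h1 (mul_mem h2 p_mem)) (mul_mem h3 (pow_mem p_mem _)))

lemma Ser.const (h : x ∈ OO p) : Ser p x x 0 0 :=
  ⟨h, zero_mem _, zero_mem _, cg.of_eq (by ring)⟩

lemma Ser.mk_eq (ha : a ∈ OO p) (hb : b ∈ OO p) (hc : c ∈ OO p) (h : x = a + b*p+c*p^2) : Ser p x a b c :=
  ⟨ha, hb, hc, cg.of_eq h⟩

lemma Ser.add (h : Ser p x a b c) (h' : Ser p y a' b' c') : Ser p (x+y) (a+a') (b+b') (c+c') := by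
  obtain ⟨h1, h2, h3, h4⟩ := h
  obtain ⟨h1', h2', h3', h4'⟩ := h'
  refine ⟨add_mem h1 h1', add_mem h2 h2', add_mem h3 h3', (h4.add h4').trans (cg.of_eq (by ring))⟩

lemma Ser.mul (h : Ser p x a b c) (h' : Ser p y a' b' c') :
    Ser p (x*y) (a*a') (a*b'+b*a') (a*c'+b*b'+c*a') := by
  have hy := h'.mem
  obtain ⟨h1, h2, h3, h4⟩ := h
  obtain ⟨h1', h2', h3', h4'⟩ := h'
  refine ⟨mul_mem h1 h1', add_mem (mul_mem h1 h2') (mul_mem h2 h1'),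
    add_mem (add_mem (mul_mem h1 h3') (mul_mem h2 h2')) (mul_mem h3 h1'), ?_⟩
  refine (h4.mul h4' (add_mem (add_mem h1 (mul_mem h2 p_mem)) (mul_mem h3 (pow_mem p_mem _))) hy).trans ?_
  exact ⟨b*c'+c*b' + c*c'*p, add_mem (add_mem (mul_mem h2 h3') (mul_mem h3 h2'))
    (mul_mem (mul_mem h3 h3') p_mem), by ring⟩

lemma Ser.smul (k : ℚ) (hk : k ∈ OO p) (h : Ser p x a b c) : Ser p (k*x) (k*a) (k*b) (k*c) := by
  obtain ⟨h1, h2, h3, h4⟩ := h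
  exact ⟨mul_mem hk h1, mul_mem hk h2, mul_mem hk h3, (h4.mul_left hk).trans (cg.of_eq (by ring))⟩

lemma inv_mem_of_cg (h : cg p 1 x 1) : x⁻¹ ∈ OO p ∧ x ≠ 0 := by
  obtain ⟨z, ⟨e, f, hf, hz⟩, h⟩ := h
  have hf0 : (f:ℚ) ≠ 0 := by
    intro h0; apply hf
    have : f = 0 := by exact_mod_cast h0
    simp [this]
  have hz' : z = e / f := by rw [eq_div_iff hf0, hz]
  have hd : ¬ (p:ℤ) ∣ f + p*e := by
    intro hd; exact hf ((Int.dvd_add_left (Dvd.intro _ rfl)).mp hd)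
  have hd0 : ((f + p*e : ℤ):ℚ) ≠ 0 := by
    intro h0; apply hd
    have : f + p*e = 0 := by exact_mod_cast h0
    simp [this]
  have hx : x = ((f + p*e : ℤ):ℚ) / f := by
    have : x = 1 + p * z := by linear_combination h
    rw [this, hz']; push_cast; field_simp
  constructor
  · rw [hx, inv_div, div_eq_mul_inv]
    exact mul_mem (intCast_mem _ _) (OO_int_inv hd)
  · rw [hx]; exact div_ne_zero hd0 hf0

lemma Ser.cg1 (h : Ser p x a b c) : cg p 1 x a := by
  obtain ⟨h1, h2, h3, h4⟩ := h
  exact (h4.mono (by norm_num)).trans ⟨b + c*p, add_mem h2 (mul_mem h3 p_mem), by ring⟩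

lemma Ser.inv (h : Ser p x 1 b c) : Ser p x⁻¹ 1 (-b) (b^2-c) := by
  obtain ⟨hi, h0⟩ := inv_mem_of_cg h.cg1
  obtain ⟨h1, h2, h3, h4⟩ := h
  have m3 : b^2 - c ∈ OO p := sub_mem (pow_mem h2 _) h3
  refine ⟨h1, neg_mem h2, m3, ?_⟩
  apply cg.cancel (u := x) hi h0
  rw [mul_inv_cancel₀ h0]
  have hm : (1 + -b * p + (b^2-c)*p^2) ∈ OO p :=
    add_mem (add_mem h1 (mul_mem (neg_mem h2) p_mem)) (mul_mem m3 (pow_mem p_mem _))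
  refine cg.symm ((h4.mul_right hm).trans ?_)
  refine ⟨b*(b^2-c) - b*c + c*(b^2-c)*p, ?_, by ring⟩
  exact add_mem (sub_mem (mul_mem h2 m3) (mul_mem h2 h3)) (mul_mem (mul_mem h3 m3) p_mem)

lemma Ser.cg_of (h : Ser p x a b c) (h' : Ser p y a' b' c') (ha : a = a') (hb : b = b') (hc : c = c') :
    cg p 3 x y := by
  subst ha hb hc
  exact h.2.2.2.trans h'.2.2.2.symm

lemma Ser.congr (h : Ser p x a b c) (hx : x = y) (ha : a = a') (hb : b = b') (hc : c = c') :
    Ser p y a' b' c' := by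
  subst hx ha hb hc
  exact h

variable {m : ℕ}

lemma h1_mem (hpm : p = 4*m+1) {k : ℕ} (hk : k ≤ 4*m) : h1 k ∈ OO p :=
  sum_mem fun i hi => (inv_succ hpm (by simp at hi; omega))

lemma EE_ser (hpm : p = 4*m+1) (τ q : ℚ) (hq : q = p * τ) (hτ : τ ∈ OO p) {k : ℕ} (hk : k ≤ 4*m) :
    Ser p (EE q k) 1 (τ * h1 k) (τ^2 * ((h1 k^2 - h2 k)*2⁻¹)) := by
  refine ⟨one_mem _, mul_mem hτ (h1_mem hpm hk), mul_mem (pow_mem hτ _) (mul_mem (sub_mem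
    (pow_mem (h1_mem hpm hk) _) (h2_mem hpm hk)) (inv2 hpm)), ?_⟩
  have := prod_expand1 (inv2 hpm) (k := k) (x := fun i => τ * ((i:ℚ)+1)⁻¹)
    (fun i hi => mul_mem hτ (inv_succ hpm (by omega)))
  refine (cg.of_eq ?_).trans (this.trans (cg.of_eq ?_))
  · unfold EE; apply prod_congr rfl; intro i _; rw [hq]; ring
  · rw [← mul_sum]
    have : ∑ i ∈ range k, (τ * ((i:ℚ)+1)⁻¹)^2 = τ^2 * h2 k := by
      unfold h2; rw [mul_sum]; apply sum_congr rfl; intro i _; ring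
    rw [this]
    change _ + p * (τ * h1 k) + p^2 * (((τ * h1 k)^2 - _) * _) = _
    ring

lemma EE_ser2 (hpm : p = 4*m+1) (τ q : ℚ) (hq : q = p * τ) (hτ : τ ∈ OO p) :
    Ser p (EE q (2*m)) 1 (τ * h1 (2*m)) (τ^2 * (h1 (2*m)^2*2⁻¹)) := by
  obtain ⟨a1, a2, a3, a4⟩ := EE_ser hpm τ q hq hτ (k := 2*m) (by omega)
  refine ⟨a1, a2, mul_mem (pow_mem hτ _) (mul_mem (pow_mem (h1_mem hpm (by omega)) _) (inv2 hpm)),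
    a4.trans ?_⟩
  have b1 := ((h2_zero hpm).p_mul 2).mul_left (c := τ^2 * 2⁻¹) (mul_mem (pow_mem hτ _) (inv2 hpm))
  have b2 := (cg.refl (p := p) (r := 3) (1 + τ * h1 (2*m) * p + (τ^2 * (h1 (2*m)^2*2⁻¹)) * p^2)).sub b1
  refine (cg.of_eq ?_).trans (b2.trans (cg.of_eq ?_)) <;> ring

/-- Wolstenholme. -/
lemma EE_p_p (hpm : p = 4*m+1) : cg p 3 (EE p p) 2 := by
  have hpq : (p:ℚ) = 4*m+1 := by rw [hpm]; push_cast; ring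
  have z2 : cg p 1 (h2 (4*m)) 0 := by
    have a := h2_refl hpm (le_refl (2*m))
    simp only [Nat.sub_self] at a
    have b := a.trans ((h2_zero hpm).mul_left (c := 2) (by exact_mod_cast natCast_mem (OO p) 2))
    rw [show 2*m+2*m = 4*m by ring] at b
    simpa [h2] using b
  have z1 : cg p 2 (h1 (4*m)) 0 := by
    apply cg.cancel (u := 2) (inv2 hpm) (by norm_num)
    have e1 : 2 * h1 (4*m) = (p:ℚ)^1 * ∑ i ∈ range (4*m), (((i:ℚ)+1)⁻¹ * (((4*m-1-i:ℕ):ℚ)+1)⁻¹) := by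
      have r := sum_range_reflect (fun i:ℕ => ((i:ℚ)+1)⁻¹) (4*m)
      rw [two_mul]
      nth_rewrite 2 [h1]
      rw [← r, h1, ← sum_add_distrib, mul_sum]
      apply sum_congr rfl
      intro i hi
      simp only [mem_range] at hi
      have : ((4*m-1-i:ℕ):ℚ) + 1 = p - (i+1) := by
        rw [show 4*m-1-i = 4*m-(i+1) by omega, Nat.cast_sub (by omega), hpq]; push_cast; ring
      have h0 : ((4*m-1-i:ℕ):ℚ) + 1 ≠ 0 := by positivity
      rw [this] at h0 ⊢
      field_simp
      ring
    rw [e1]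
    have e2 : cg p 1 (∑ i ∈ range (4*m), (((i:ℚ)+1)⁻¹ * (((4*m-1-i:ℕ):ℚ)+1)⁻¹))
        (∑ i ∈ range (4*m), (((i:ℚ)+1)⁻¹ * -(((i:ℚ)+1)⁻¹))) := by
      apply cg.sum
      intro i hi
      simp only [mem_range] at hi
      apply cg.mul_left (inv_succ hpm hi)
      have : ((4*m-1-i:ℕ):ℚ) + 1 = p - (i+1) := by
        rw [show 4*m-1-i = 4*m-(i+1) by omega, Nat.cast_sub (by omega), hpq]; push_cast; ring
      have h0 : ((i:ℚ)+1) ≠ 0 := by positivity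
      have b1 : cg p 1 (((4*m-1-i:ℕ):ℚ) + 1) (-((i:ℚ)+1)) := ⟨1, one_mem _, by rw [this]; ring⟩
      have b2 := b1.inv (inv_succ hpm (by omega)) (by rw [inv_neg]; exact neg_mem (inv_succ hpm (by omega)))
        (by positivity) (neg_ne_zero.mpr h0)
      rwa [inv_neg] at b2
    have e3 : ∑ i ∈ range (4*m), (((i:ℚ)+1)⁻¹ * -(((i:ℚ)+1)⁻¹)) = - h2 (4*m) := by
      unfold h2; rw [← sum_neg_distrib]; apply sum_congr rfl; intro i _; ring
    rw [e3] at e2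
    have e4 := (e2.trans ((cg.refl (p := p) (r := 1) 0).sub z2 |> fun h => by simpa using h)).p_mul 1
    simpa using e4
  have e : EE p p = EE p (4*m) * 2 := by
    have : EE (p:ℚ) (4*m+1) = EE p (4*m) * 2 := by
      rw [EE_succ]; push_cast; rw [← hpq, div_self]
      · norm_num
      · rw [hpq]; positivity
    rw [← this, ← hpm]
  rw [e]
  obtain ⟨a1, a2, a3, a4⟩ := EE_ser hpm 1 p (by ring) (one_mem _) (k := 4*m) (le_refl _)
  have c1 := z1.p_mul 1
  have hm := h1_mem hpm (le_refl (4*m))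
  have c2 := (((z1.mono (s := 1) (by norm_num)).mul_left hm).sub z2).mul_right (inv2 hpm) |>.p_mul 2
  have c3 := a4.trans (((cg.refl (p := p) (r := 3) 1).add c1 |>.add c2).symm.symm |> fun h => (cg.of_eq (by ring)).trans h)
  have c4 := c3.mul_right (c := 2) (by exact_mod_cast natCast_mem (OO p) 2)
  refine c4.trans (cg.of_eq (by ring))

end

section
variable {p : ℕ} [hp : Fact p.Prime]
variable {m : ℕ}

lemma p_not_dvd_choose (hpm : p = 4*m+1) : ¬ p ∣ (2*m).choose m := by
  intro h
  have h1 : (2*m).choose m ∣ (2*m).factorial := by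
    rw [← Nat.choose_mul_factorial_mul_factorial (show m ≤ 2*m by omega), mul_assoc]
    exact Dvd.intro _ rfl
  have := (hp.out.dvd_factorial).mp (h.trans h1)
  omega

lemma choose_inv (hpm : p = 4*m+1) : ((2*m).choose m : ℚ)⁻¹ ∈ OO p := OO_nat_inv (p_not_dvd_choose hpm)

lemma Dn_unit (hpm : p = 4*m+1) : (∏ i ∈ range (2*m), (4*(i:ℚ)+3))⁻¹ ∈ OO p := by
  rw [← prod_inv_distrib]
  apply prod_mem
  intro i hi
  simp only [mem_range] at hi
  have : ((4*i+3 : ℕ):ℚ)⁻¹ ∈ OO p := by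
    apply OO_nat_inv
    rintro ⟨k, hk⟩
    have hm := m_pos hpm
    have : k < 2 := by
      by_contra h
      have : p * 2 ≤ p * k := Nat.mul_le_mul_left _ (by omega)
      omega
    interval_cases k <;> omega
  exact_mod_cast this

lemma N_cg (hpm : p = 4*m+1) (t : ℕ) (ht : m = t+1) :
    cg p 1 (((2*m).choose m : ℚ)^2 * ((∏ i ∈ range t, (4*(i:ℚ)+5)) * ∏ i ∈ range m, (4*((m+i:ℕ):ℚ)+5)))
      (∏ i ∈ range (2*m), (4*(i:ℚ)+3)) := by
  have hpq : (p:ℚ) = 4*m+1 := by rw [hpm]; push_cast; ring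
  have htq : (m:ℚ) = t+1 := by rw [ht]; push_cast; ring
  have four : (4:ℚ) ∈ OO p := by exact_mod_cast natCast_mem (OO p) 4
  have f1 : cg p 1 (∏ i ∈ range m, (4*((m+i:ℕ):ℚ)+5)) (∏ i ∈ range m, (4*((i:ℚ)+1))) := by
    apply cg.prod
    · intro i _
      exact ⟨1, one_mem _, by rw [hpq]; push_cast; ring⟩
    · intro i _
      exact mul_mem four (add_mem (natCast_mem _ _) (one_mem _))
  have f2 : cg p 1 (∏ i ∈ range t, (4*(i:ℚ)+5)) (∏ i ∈ range t, (-4*((i:ℚ)+1))) := by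
    rw [← prod_range_reflect]
    apply cg.prod
    · intro i hi
      simp only [mem_range] at hi
      refine ⟨1, one_mem _, ?_⟩
      rw [show t - 1 - i = t - (i+1) by omega, Nat.cast_sub (by omega), hpq, htq]; push_cast; ring
    · intro i _
      exact mul_mem (neg_mem four) (add_mem (natCast_mem _ _) (one_mem _))
  have f3 : cg p 1 (∏ i ∈ range (2*m), (4*(i:ℚ)+3)) (∏ i ∈ range (2*m), (4*((m:ℚ)+i+1))) := by
    apply cg.prod
    · intro i _
      exact ⟨-1, neg_mem (one_mem _), by rw [hpq]; ring⟩
    · intro i _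
      exact mul_mem four (add_mem (add_mem (natCast_mem _ _) (natCast_mem _ _)) (one_mem _))
  have f4 : cg p 1 (∏ i ∈ range m, ((m:ℚ)+(m+i:ℕ)+1)) (∏ i ∈ range m, (-1*((m:ℚ)+i+1))) := by
    rw [← prod_range_reflect]
    apply cg.prod
    · intro i hi
      simp only [mem_range] at hi
      refine ⟨1, one_mem _, ?_⟩
      rw [show m + (m - 1 - i) = 2*m - (i+1) by omega, Nat.cast_sub (by omega), hpq]; push_cast; ring
    · intro i _
      exact mul_mem (neg_mem (one_mem _)) (add_mem (add_mem (natCast_mem _ _) (natCast_mem _ _)) (one_mem _))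
  set A1 := ∏ i ∈ range m, ((m:ℚ)+i+1) with hA1
  set Ft := ∏ i ∈ range t, ((i:ℚ)+1) with hFt
  have hA1m : A1 ∈ OO p := prod_mem fun i _ => add_mem (add_mem (natCast_mem _ _) (natCast_mem _ _)) (one_mem _)
  have hFtm : Ft ∈ OO p := prod_mem fun i _ => add_mem (natCast_mem _ _) (one_mem _)
  have e1 : ∏ i ∈ range m, (4*((i:ℚ)+1)) = 4^m * (Ft * m) := by
    rw [prod_mul_distrib]; simp only [prod_const, card_range]
    congr 1
    rw [ht, prod_range_succ]; push_cast; rfl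
  have e2 : ∏ i ∈ range t, (-4*((i:ℚ)+1)) = (-4)^t * Ft := by
    rw [prod_mul_distrib]; simp only [prod_const, card_range]; rfl
  have e3 : ∏ i ∈ range (2*m), (4*((m:ℚ)+i+1)) = 4^(2*m) * (A1 * ∏ i ∈ range m, ((m:ℚ)+(m+i:ℕ)+1)) := by
    rw [prod_mul_distrib]; simp only [prod_const, card_range]
    congr 1
    rw [two_mul, prod_range_add]
  have e4 : ∏ i ∈ range m, (-1*((m:ℚ)+i+1)) = (-1)^m * A1 := by
    rw [prod_mul_distrib]; simp only [prod_const, card_range]; rfl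
  have e5 : A1 = (2*m).choose m * (Ft * m) := by
    have : Ft * m = ∏ i ∈ range m, ((i:ℚ)+1) := by rw [ht, prod_range_succ]; push_cast; rfl
    rw [this, choose_EE, EE, ← prod_mul_distrib]
    apply prod_congr rfl
    intro i _
    have : (i:ℚ)+1 ≠ 0 := by positivity
    field_simp
    ring
  rw [e1] at f1
  rw [e2] at f2
  rw [e3] at f3
  rw [e4] at f4
  have hc : ((2*m).choose m : ℚ) ∈ OO p := natCast_mem _ _
  have g3 := f3.trans ((f4.mul_left hA1m).mul_left (c := 4^(2*m)) (pow_mem four _))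
  have mem1 : (4:ℚ)^m * (Ft * m) ∈ OO p := mul_mem (pow_mem four _) (mul_mem hFtm (natCast_mem _ _))
  have mem2 : (-4:ℚ)^t * Ft ∈ OO p := mul_mem (pow_mem (neg_mem four) _) hFtm
  have g1 := (f2.mul' f1 mem2 mem1).mul_left (c := ((2*m).choose m : ℚ)^2) (pow_mem hc 2)
  have g2 := g1.mul_left (c := 4*m) (mul_mem four (natCast_mem _ _))
  -- replace `4 m` by `-1`
  have k1 : ∀ z ∈ OO p, cg p 1 (-z) (4*m*z) := fun z hz => ⟨-z, neg_mem hz, by rw [hpq]; ring⟩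
  have hN : ((2*m).choose m : ℚ)^2 * ((∏ i ∈ range t, (4*(i:ℚ)+5)) * ∏ i ∈ range m, (4*((m+i:ℕ):ℚ)+5)) ∈ OO p :=
    g1.mem_left (mul_mem (pow_mem hc 2) (mul_mem mem2 mem1))
  have k2 := (k1 _ hN).trans g2
  have k3 : 4 * (m:ℚ) * (((2*m).choose m : ℚ)^2 * ((-4)^t * Ft * (4^m * (Ft * m)))) =
      - (4^(2*m) * (A1 * ((-1)^m * A1))) := by
    have : (4:ℚ)^(2*m) = 4^m * 4^(t+1) := by rw [← ht, ← pow_add, two_mul]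
    rw [this]
    have : (-1:ℚ)^m = - (-1)^t := by rw [ht, pow_succ]; ring
    rw [this, e5, neg_pow (4:ℚ) t]
    ring
  rw [k3] at k2
  have k4 := (k2.mul_left (c := -1) (neg_mem (one_mem _))).trans ((cg.of_eq (by ring)).trans g3.symm)
  exact (cg.of_eq (by ring)).trans k4

lemma T_final (hpm : p = 4*m+1) : cg p 3 (∑ k ∈ range (2*m+1), (4*(k:ℚ)+1) * bb k ^ 3)
    (p^2 * (((2*m).choose m : ℚ)⁻¹)^2) := by
  refine (T_cg hpm).trans ?_
  obtain ⟨t, ht⟩ : ∃ t, m = t+1 := ⟨m-1, by have := m_pos hpm; omega⟩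
  have hpq : (p:ℚ) = 4*m+1 := by rw [hpm]; push_cast; ring
  have h := N_cg hpm t ht
  have hD := Dn_unit hpm
  have hD0 : (∏ i ∈ range (2*m), (4*(i:ℚ)+3)) ≠ 0 := (prod_pos fun i _ => by positivity).ne'
  have e : ∏ i ∈ range (2*m), (4*(i:ℚ)+5) = p * ((∏ i ∈ range t, (4*(i:ℚ)+5)) * ∏ i ∈ range m, (4*((m+i:ℕ):ℚ)+5)) := by
    rw [two_mul, prod_range_add]
    have : ∏ i ∈ range m, (4*(i:ℚ)+5) = (∏ i ∈ range t, (4*(i:ℚ)+5)) * p := by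
      rw [hpq, ht, prod_range_succ]; push_cast; ring
    rw [this]; ring
  rw [prod_div_distrib, e]
  have hc0 : ((2*m).choose m : ℚ) ≠ 0 := by
    have := Nat.choose_pos (show m ≤ 2*m by omega)
    positivity
  generalize (∏ i ∈ range (2*m), (4*(i:ℚ)+3)) = Dn at *
  generalize ((∏ i ∈ range t, (4*(i:ℚ)+5)) * ∏ i ∈ range m, (4*((m+i:ℕ):ℚ)+5)) = N at *
  have hci := choose_inv hpm
  have := ((h.mul_right hD).mul_left (pow_mem hci 2)).p_mul 2
  refine (cg.of_eq ?_).trans (this.trans (cg.of_eq ?_))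
  · field_simp
  · field_simp

end

section
variable {p : ℕ} [hp : Fact p.Prime]
variable {m : ℕ}

lemma P_ser (hpm : p = 4*m+1) : ∃ z, Ser p z 1 0 (-(h2 m)*8⁻¹) ∧
    ∏ i ∈ range m, (((2*i+1:ℚ)^2 + (p:ℚ)^2/4) / ((2*i+2:ℚ)^2 + (p:ℚ)^2/4)) = bb m ^ 2 * z := by
  have hm := m_pos hpm
  have i2 := inv2 hpm
  have i4 := inv4 hpm
  have i16 : (16:ℚ)⁻¹ ∈ OO p := by
    have := mul_mem i4 i4
    norm_num at this ⊢; exact this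
  have i8 : (8:ℚ)⁻¹ ∈ OO p := by
    have := mul_mem i4 i2
    norm_num at this ⊢; exact this
  have o2m := o2_mem hpm (show m ≤ 2*m by omega)
  have h2m := h2_mem hpm (show m ≤ 4*m by omega)
  have a1 := prod_expand2 (p := p) (k := m) (x := fun i => 4⁻¹ * ((2*(i:ℚ)+1)⁻¹)^2) (v := fun i => 4⁻¹ * ((2*(i:ℚ)+1)⁻¹)^2)
    (fun i _ => cg.refl _) (fun i hi => mul_mem i4 (pow_mem (inv_odd hpm (by omega)) _))
  have a2 := prod_expand2 (p := p) (k := m) (x := fun i => 16⁻¹ * (((i:ℚ)+1)⁻¹)^2) (v := fun i => 16⁻¹ * (((i:ℚ)+1)⁻¹)^2)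
    (fun i _ => cg.refl _) (fun i hi => mul_mem i16 (pow_mem (inv_succ hpm (by omega)) _))
  rw [← mul_sum] at a1 a2
  change cg p 3 _ (1 + p^2 * (4⁻¹ * o2 m)) at a1
  change cg p 3 _ (1 + p^2 * (16⁻¹ * h2 m)) at a2
  have b0 := ((o2_cg' hpm (show m ≤ 2*m by omega)).mul_left i16).p_mul 2
  rw [show 2*m - m = m by omega] at b0
  have s1 : Ser p _ 1 0 (-16⁻¹ * h2 m) := ⟨one_mem _, zero_mem _, mul_mem (neg_mem i16) h2m,
    a1.trans (((cg.refl (p := p) (r := 3) 1).add b0) |> fun h => (cg.of_eq (by ring)).trans (h.trans (cg.of_eq (by ring))))⟩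
  have s2 : Ser p _ 1 0 (16⁻¹ * h2 m) := ⟨one_mem _, zero_mem _, mul_mem i16 h2m,
    a2.trans (cg.of_eq (by ring))⟩
  refine ⟨_, (s1.mul s2.inv).congr rfl (by ring) (by ring) (by ring), ?_⟩
  unfold bb
  rw [← prod_inv_distrib, ← prod_mul_distrib, ← prod_pow, ← prod_mul_distrib]
  apply prod_congr rfl
  intro i _
  have x1 : (2*(i:ℚ)+1) ≠ 0 := by positivity
  have x2 : ((i:ℚ)+1) ≠ 0 := by positivity
  have x3 : (2*i+2:ℚ)^2 + (p:ℚ)^2/4 ≠ 0 := by positivity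
  have x4 : 1 + (p:ℚ)^2 * (16⁻¹ * ((i:ℚ)+1)⁻¹^2) ≠ 0 := by positivity
  have x5 : 1 + (p:ℚ)^2 * (16⁻¹ * ((i:ℚ)+1)⁻¹^2) = ((2*i+2:ℚ)^2 + (p:ℚ)^2/4) / (4*((i:ℚ)+1)^2) := by
    field_simp; ring
  rw [x5, inv_div]
  field_simp
  ring

lemma B_ser (hpm : p = 4*m+1) : ∃ z, Ser p z 8 (-4*(h1 (2*m) - h1 m)) ((h1 (2*m) - h1 m)^2 + h2 m * 2⁻¹) ∧
    (1-(p:ℚ)) * (15 * (2*m).choose m - 20 * (6*m).choose m + 6 * (10*m).choose m + 3 * (10*m).choose (5*m))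
      = (2*m).choose m * z := by
  have hpq : (p:ℚ) = 4*m+1 := by rw [hpm]; push_cast; ring
  have hm := m_pos hpm
  have i2 := inv2 hpm
  have i3 := inv3 hpm
  have i4 := inv4 hpm
  have nat : ∀ k : ℕ, (k:ℚ) ∈ OO p := fun k => natCast_mem _ _
  have int : ∀ k : ℤ, (k:ℚ) ∈ OO p := fun k => intCast_mem _ _
  have two : (2:ℚ) ∈ OO p := by exact_mod_cast nat 2
  have lin : ∀ a b : ℤ, Ser p (a + b * p) a b 0 := fun a b => Ser.mk_eq (int _) (int _) (zero_mem _) (by ring)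
  -- exponential pieces
  have E1 := EE_ser hpm 1 p (by ring) (one_mem _) (k := m) (by omega)
  have E2 := EE_ser2 hpm 1 p (by ring) (one_mem _)
  have E3 := EE_ser hpm 2 (2*p:ℕ) (by push_cast; ring) two (k := m) (by omega)
  have E4 := EE_ser2 hpm 2 (2*p:ℕ) (by push_cast; ring) two
  have W : Ser p (EE p p) 2 0 0 := ⟨two, zero_mem _, zero_mem _, (EE_p_p hpm).trans (cg.of_eq (by ring))⟩
  have X := E2.mul E1.inv
  have Y := E4.mul E3.inv
  have Z := E4.mul (E1.inv.mul E1.inv)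
  -- rational factors
  have q1 : Ser p (1 - 3*p)⁻¹ 1 3 9 := by
    have := ((lin 1 (-3)).congr rfl (by norm_num) rfl rfl : Ser p _ 1 _ _).inv
    exact this.congr (by push_cast; ring_nf) rfl (by norm_num) (by norm_num)
  have q2 : Ser p (1 - 5*p)⁻¹ 1 5 25 := by
    have := ((lin 1 (-5)).congr rfl (by norm_num) rfl rfl : Ser p _ 1 _ _).inv
    exact this.congr (by push_cast; ring_nf) rfl (by norm_num) (by norm_num)
  have q3 : Ser p (1 - 5/3*p)⁻¹ 1 (5/3) (25/9) := by
    have h53 : (5/3:ℚ) ∈ OO p := by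
      have := mul_mem (nat 5) i3
      rwa [← div_eq_mul_inv] at this
    have : Ser p (1 - 5/3*p) 1 (-(5/3)) 0 := Ser.mk_eq (one_mem _) (neg_mem h53) (zero_mem _) (by ring)
    exact this.inv.congr rfl rfl (by norm_num) (by norm_num)
  have r1 := ((lin 1 (-5)).mul q1).smul 2⁻¹ i2
  have r2 := (((lin (-5) 9).mul (lin (-1) 9)).mul (q3.mul q2)).smul (4⁻¹ * 3⁻¹) (mul_mem i4 i3)
  have r3 := ((lin 1 (-5)).mul q3).smul (4⁻¹ * 3⁻¹) (mul_mem i4 i3)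
  have t0 := Ser.const (p := p) (x := 15) (by exact_mod_cast nat 15)
  have t1 := (r1.mul X).smul (-20) (by exact_mod_cast int (-20))
  have t2 := (r2.mul Y).smul 6 (by exact_mod_cast nat 6)
  have t3 := ((W.mul r3).mul Z).smul 3 (by exact_mod_cast nat 3)
  have tot := (lin 1 (-1)).mul (((t0.add t1).add t2).add t3)
  refine ⟨_, tot.congr rfl ?_ ?_ ?_, ?_⟩
  · norm_num
  · push_cast; ring
  · push_cast; ring
  · rw [choose6 m p hpm, choose10a m p hpm, choose10b m p hpm]
    have y1 : (5*m+1:ℚ)/(6*m+1) = 2⁻¹ * (((1:ℤ) + (-5:ℤ)*(p:ℚ)) * (1-3*(p:ℚ))⁻¹) := by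
      rw [hpq]; push_cast
      have z1 : (1 - 3*(4*(m:ℚ)+1)) = -2*(6*m+1) := by ring
      rw [z1]; field_simp; ring
    have z2 : (1 - 5*(4*(m:ℚ)+1)) = -2*(10*m+2) := by ring
    have z3 : (1 - 5/3*(4*(m:ℚ)+1)) = -(2/3)*(10*m+1) := by ring
    have y2 : (9*m+1)*(9*m+2)/((10*m+1)*(10*m+2):ℚ) = 4⁻¹ * 3⁻¹ * ((((-5:ℤ) + (9:ℤ)*(p:ℚ)) * ((-1:ℤ) + (9:ℤ)*(p:ℚ)))
        * ((1-5/3*(p:ℚ))⁻¹ * (1-5*(p:ℚ))⁻¹)) := by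
      rw [hpq]; push_cast
      rw [z2, z3]; field_simp; ring
    have y3 : (5*m+1)^2/((10*m+1)*(10*m+2):ℚ) = 4⁻¹ * 3⁻¹ * (((1:ℤ) + (-5:ℤ)*(p:ℚ))* (1-5/3*(p:ℚ))⁻¹) := by
      rw [hpq]; push_cast
      rw [z3]; field_simp; ring
    rw [y1, y2, y3]
    generalize (1-3*(p:ℚ))⁻¹ = u1
    generalize (1-5*(p:ℚ))⁻¹ = u2
    generalize (1-5/3*(p:ℚ))⁻¹ = u3
    generalize (EE (p:ℚ) m)⁻¹ = u4
    generalize (EE (2*p:ℕ) m)⁻¹ = u5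
    push_cast
    ring

lemma bb_ser (hpm : p = 4*m+1) : ∃ z, Ser p z 1 (-(h1 (2*m) - h1 m)*2⁻¹) (((h1 (2*m) - h1 m)^2 + h2 m)*2⁻¹^3) ∧
    bb m = (-1)^m * (2*m).choose m * z := by
  have i2 := inv2 hpm
  have E1 := EE_ser hpm (-1*2⁻¹) (-p/2) (by ring) (mul_mem (neg_mem (one_mem _)) i2) (k := m) (by omega)
  have E2 := EE_ser2 hpm (-1*2⁻¹) (-p/2) (by ring) (mul_mem (neg_mem (one_mem _)) i2)
  refine ⟨_, (E2.mul E1.inv).congr rfl ?_ ?_ ?_, bb_EE m p hpm (inv_mem_of_cg E1.cg1).2⟩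
  · norm_num
  · ring
  · ring

/-- The integer `V`. -/
def VV (m : ℕ) : ℤ := (4*m) * (15 * (2*m).choose m - 20 * (6*m).choose m + 6 * (10*m).choose m + 3 * (10*m).choose (5*m))

lemma VV_cast (hpm : p = 4*m+1) : (VV m : ℚ) = - ((1-(p:ℚ)) * (15 * (2*m).choose m - 20 * (6*m).choose m + 6 * (10*m).choose m + 3 * (10*m).choose (5*m))) := by
  have hpq : (p:ℚ) = 4*m+1 := by rw [hpm]; push_cast; ring
  rw [hpq]; unfold VV; push_cast; ring

lemma VV_cg1 (hpm : p = 4*m+1) : cg p 1 (VV m : ℚ) (-8 * (2*m).choose m) := by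
  obtain ⟨z, hz, h⟩ := B_ser hpm
  rw [VV_cast hpm, h]
  have := (hz.cg1.mul_left (c := -(2*m).choose m) (neg_mem (natCast_mem _ _)))
  exact (cg.of_eq (by ring)).trans (this.trans (cg.of_eq (by ring)))

lemma VV_cg3 (hpm : p = 4*m+1) : cg p 3 ((VV m : ℚ)^2) (64 * ∑ k ∈ range (2*m+1), bb k ^ 3) := by
  have n64 : (64:ℚ) ∈ OO p := by exact_mod_cast natCast_mem (OO p) 64
  have hS := ((S0_cg hpm).mul_left n64).symm
  refine cg.trans ?_ hS
  obtain ⟨z1, s1, h1⟩ := B_ser hpm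
  obtain ⟨z2, s2, h2⟩ := P_ser hpm
  obtain ⟨z3, s3, h3⟩ := bb_ser hpm
  rw [VV_cast hpm, h1, h2, h3]
  have key := (s1.mul s1).cg_of (((s3.mul s3).mul s2).smul 64 n64) (by norm_num) (by ring) (by ring)
  have := key.mul_left (c := ((2*m).choose m)^2) (pow_mem (natCast_mem _ _) _)
  have e : ((-1:ℚ)^m)^2 = 1 := by rw [← pow_mul, mul_comm, pow_mul]; simp
  refine (cg.of_eq (by ring)).trans (this.trans (cg.of_eq ?_))
  linear_combination (-64 * ((2*m).choose m : ℚ)^2 * z3^2 * z2) * e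

end

section
variable {p : ℕ} [hp : Fact p.Prime]
variable {m : ℕ}

lemma p_not_dvd_VV (hpm : p = 4*m+1) : ¬ (p:ℤ) ∣ VV m := by
  intro h
  have h1 := (VV_cg1 hpm).num_dvd
  have e : (VV m : ℚ) - -8 * (2*m).choose m = ((VV m + 8 * (2*m).choose m : ℤ) : ℚ) := by push_cast; ring
  rw [e, Rat.num_intCast, pow_one] at h1
  have h2 : (p:ℤ) ∣ ((8 * (2*m).choose m : ℕ) : ℤ) := by
    have := dvd_sub h1 h
    simpa using this
  have h3 : p ∣ 8 * (2*m).choose m := by exact_mod_cast h2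
  rcases hp.out.dvd_mul.mp h3 with h4 | h4
  · have : p ∣ 2 := hp.out.dvd_of_dvd_pow (show p ∣ 2^3 from h4)
    have := Nat.le_of_dvd (by norm_num) this
    have := m_pos hpm
    omega
  · exact p_not_dvd_choose hpm h4

lemma final_cg (hpm : p = 4*m+1) (x A : ℤ) (hx : ¬ (p:ℤ) ∣ x) (hA : A^2 = x^2) (hG : (p:ℤ)^3 ∣ VV m * (16*A - VV m) - 64*p) :
    cg p 3 (∑ k ∈ range p, (k:ℚ)^2 * bb k ^ 3) ((x:ℚ)^2/6 - (p:ℚ)/12 - (p:ℚ)^2/(24*(x:ℚ)^2)) := by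
  have nat : ∀ k : ℕ, (k:ℚ) ∈ OO p := fun k => natCast_mem _ _
  have int : ∀ k : ℤ, (k:ℚ) ∈ OO p := fun k => intCast_mem _ _
  have i2 := inv2 hpm
  have i3 := inv3 hpm
  have i8 : (8:ℚ)⁻¹ ∈ OO p := by
    have := pow_mem i2 3
    norm_num at this ⊢; exact this
  have i24 : (24:ℚ)⁻¹ ∈ OO p := by
    have := mul_mem i8 i3
    norm_num at this ⊢; exact this
  have hV := p_not_dvd_VV hpm
  have hVi := OO_int_inv hV
  have hV0 : (VV m : ℚ) ≠ 0 := by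
    intro h; apply hV; have : VV m = 0 := by exact_mod_cast h
    simp [this]
  have hxi := OO_int_inv hx
  have hx0 : (x : ℚ) ≠ 0 := by
    intro h; apply hx; have : x = 0 := by exact_mod_cast h
    simp [this]
  have hAq : (A:ℚ)^2 = x^2 := by exact_mod_cast hA
  obtain ⟨z, hz⟩ := hG
  have hzq : (VV m : ℚ) * (16*A - VV m) - 64*p = p^3 * z := by exact_mod_cast hz
  have c1 := VV_cg1 hpm
  have c3 := VV_cg3 hpm
  generalize (VV m : ℚ) = V at *
  -- `w1`
  obtain ⟨v, hv⟩ : ∃ v, v = V * 8⁻¹ := ⟨_, rfl⟩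
  obtain ⟨ζ, hζ⟩ : ∃ ζ, ζ = (z:ℚ) * (8⁻¹)^2 := ⟨_, rfl⟩
  have hζm : ζ ∈ OO p := by rw [hζ]; exact mul_mem (int _) (pow_mem i8 2)
  have eV : V = 8 * v := by rw [hv]; ring
  have hv0 : v ≠ 0 := by rintro rfl; apply hV0; rw [eV]; ring
  have hvi : v⁻¹ ∈ OO p := by
    rw [hv, mul_inv, inv_inv]; exact mul_mem hVi (by exact_mod_cast nat 8)
  have e1 : v * (2*A - v) = p + p^3 * ζ := by
    rw [hζ]; rw [eV] at hzq; linear_combination hzq/64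
  obtain ⟨w, hw⟩ : ∃ w, w = v⁻¹ * (1 + p^2 * ζ) := ⟨_, rfl⟩
  have hwm : w ∈ OO p := by rw [hw]; exact mul_mem hvi (add_mem (one_mem _) (mul_mem (pow_mem p_mem _) hζm))
  have e2 : v * w = 1 + p^2 * ζ := by rw [hw, mul_inv_cancel_left₀ hv0]
  have e3 : 2*A - v = p * w := by
    apply mul_left_cancel₀ hv0; rw [e1]; linear_combination -(p:ℚ) * e2
  have e4 : v = 2*A - p*w := by linear_combination -e3
  -- `w^2`
  have k1 : cg p 1 (2*A*w) 1 := ⟨w^2 + p*ζ, add_mem (pow_mem hwm 2) (mul_mem p_mem hζm), by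
    rw [e4] at e2; linear_combination e2⟩
  have k2 : cg p 1 ((2*A*w)^2) 1 := by simpa using k1.pow 2 (one_mem _)
  have k3 : cg p 1 (w^2) (((2*x:ℚ)⁻¹)^2) := by
    have := k2.mul_left (c := ((2*x:ℚ)⁻¹)^2) (pow_mem (by rw [mul_inv]; exact mul_mem i2 hxi) 2)
    refine (cg.of_eq ?_).trans (this.trans (cg.of_eq (by ring)))
    rw [mul_pow, mul_pow, hAq]; field_simp
  have k4 : cg p 3 (v^2) (4*x^2 - 2*p - p^2 * ((2*x:ℚ)⁻¹)^2) := by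
    have := ((cg.refl (p := p) (r := 3) (4*x^2 - 2*p)).sub (k3.p_mul 2))
    refine cg.trans ⟨-2*ζ, mul_mem (by exact_mod_cast int (-2)) hζm, ?_⟩ this
    have : v^2 = 4*A^2 - 2*(v*(2*A-v)) - (2*A-v)^2 := by ring
    rw [this, hAq, e1, e3]; ring
  -- `S_0`
  have s0 : cg p 3 (∑ k ∈ range (2*m+1), bb k ^ 3) (v^2) := by
    have := (c3.mul_left (c := (8⁻¹)^2) (pow_mem i8 2)).symm
    refine (cg.of_eq ?_).trans (this.trans (cg.of_eq ?_))
    · ring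
    · rw [hv]; ring
  -- `T`
  have t := T_final hpm
  have hci := choose_inv hpm
  have hc0 : ((2*m).choose m : ℚ) ≠ 0 := by
    have := Nat.choose_pos (show m ≤ 2*m by omega)
    positivity
  have t1 : cg p 1 (v^2) (((2*m).choose m : ℚ)^2) := by
    have := (c1.mul_left (c := 8⁻¹) i8).pow 2 (mul_mem i8 (mul_mem (by exact_mod_cast int (-8)) (nat _)))
    refine (cg.of_eq ?_).trans (this.trans (cg.of_eq ?_))
    · rw [hv]; ring
    · ring
  have t2 : cg p 1 (v^2) ((2*x)^2) := (k4.mono (by norm_num)).trans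
    ⟨-2 - p * ((2*x:ℚ)⁻¹)^2, sub_mem (by exact_mod_cast int (-2)) (mul_mem p_mem (pow_mem (by rw [mul_inv]; exact mul_mem i2 hxi) 2)), by ring⟩
  have t3 : cg p 1 ((((2*m).choose m : ℚ)⁻¹)^2) (((2*x:ℚ)⁻¹)^2) := by
    have := (t1.symm.trans t2).inv (by rw [← inv_pow]; exact pow_mem hci 2)
      (by rw [← inv_pow, mul_inv]; exact pow_mem (mul_mem i2 hxi) 2) (pow_ne_zero _ hc0)
      (by positivity)
    rwa [← inv_pow, ← inv_pow] at this
  have t4 := t.trans (t3.p_mul 2)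
  -- assemble
  have u0 := (trunc hpm (fun _ => 1) (fun _ => one_mem _))
  simp only [one_mul] at u0
  have u1 := trunc hpm (fun k => 4*(k:ℚ)+1) (fun k => by exact_mod_cast nat (4*k+1))
  have u2 := sum_three hpm
  have U0 := u0.trans (s0.trans k4)
  have U1 := u1.trans t4
  have E : 24 * ∑ k ∈ range p, (k:ℚ)^2 * bb k ^ 3 = 2 * (∑ k ∈ range p, (12*(k:ℚ)^2+6*k+1) * bb k ^ 3)
      + (∑ k ∈ range p, bb k ^ 3) - 3 * ∑ k ∈ range p, (4*(k:ℚ)+1) * bb k ^ 3 := by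
    simp only [mul_sum, ← sum_add_distrib, ← sum_sub_distrib]
    apply sum_congr rfl; intro k _; ring
  apply cg.cancel (u := 24) i24 (by norm_num)
  rw [E]
  have R := ((u2.mul_left (c := 2) (by exact_mod_cast nat 2)).add U0).sub (U1.mul_left (c := 3) (by exact_mod_cast nat 3))
  refine R.trans (cg.of_eq ?_)
  field_simp
  ring

end

section
variable {p : ℕ} [hp : Fact p.Prime]

/-- Teichmüller lift modulo `p^3`. -/
def tau (p : ℕ) (a : ZMod p) : ZMod (p^3) := (a.val : ZMod (p^3))^(p^2)

lemma tau_int (n : ℤ) : tau p (n : ZMod p) = (n : ZMod (p^3))^(p^2) := by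
  unfold tau
  have h1 : (p:ℤ) ∣ ((n : ZMod p).val : ℤ) - n := by
    rw [← ZMod.intCast_eq_intCast_iff_dvd_sub]
    simp
  have h2 := dvd_sub_pow_of_dvd_sub h1 2
  have h3 := (ZMod.intCast_zmod_eq_zero_iff_dvd _ (p^3)).mpr (by push_cast; exact h2)
  push_cast at h3
  exact sub_eq_zero.mp h3

lemma tau_mul (a b : ZMod p) : tau p (a*b) = tau p a * tau p b := by
  obtain ⟨x, rfl⟩ := ZMod.intCast_surjective a
  obtain ⟨y, rfl⟩ := ZMod.intCast_surjective b
  rw [← Int.cast_mul, tau_int, tau_int, tau_int, Int.cast_mul, mul_pow]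

lemma tau_one : tau p 1 = 1 := by
  have := tau_int (p := p) 1
  simpa using this

lemma tau_zero : tau p 0 = 0 := by
  have := tau_int (p := p) 0
  simpa [hp.out.ne_zero] using this

lemma tau_neg_one (h : Odd p) : tau p (-1) = -1 := by
  have := tau_int (p := p) (-1)
  simpa [(h.pow : Odd (p^2)).neg_one_pow] using this

lemma tau_pow (a : ZMod p) (k : ℕ) : tau p (a^k) = tau p a ^ k := by
  induction k with
  | zero => simp [tau_one]
  | succ k ih => rw [pow_succ a, pow_succ (tau p a), tau_mul, ih]

/-- Reduction modulo `p`. -/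
def red (p : ℕ) : ZMod (p^3) →+* ZMod p := ZMod.castHom (dvd_pow_self p (by norm_num)) (ZMod p)

lemma red_tau (a : ZMod p) : red p (tau p a) = a := by
  obtain ⟨x, rfl⟩ := ZMod.intCast_surjective a
  rw [tau_int, map_pow, map_intCast, pow_two, pow_mul, ZMod.pow_card, ZMod.pow_card]

lemma red_zero {r : ZMod (p^3)} (h : red p r = 0) : ∃ s, r = p * s := by
  obtain ⟨x, rfl⟩ := ZMod.intCast_surjective r
  rw [map_intCast, ZMod.intCast_zmod_eq_zero_iff_dvd] at h
  obtain ⟨y, rfl⟩ := h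
  exact ⟨y, by push_cast; ring⟩

lemma p_cube : (p : ZMod (p^3))^3 = 0 := by
  have := ZMod.natCast_self (p^3)
  push_cast at this
  exact this

lemma red_unit {r : ZMod (p^3)} (h : red p r ≠ 0) : IsUnit r := by
  obtain ⟨t, ht⟩ := ZMod.intCast_surjective ((red p r)⁻¹)
  have h1 : red p (r * t - 1) = 0 := by
    rw [map_sub, map_mul, map_intCast, ht, mul_inv_cancel₀ h, map_one, sub_self]
  obtain ⟨s, hs⟩ := red_zero h1
  have h2 : IsNilpotent (r * t - 1) := ⟨3, by rw [hs, mul_pow, p_cube, zero_mul]⟩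
  have h3 := h2.isUnit_one_add
  rw [add_sub_cancel] at h3
  exact isUnit_of_mul_isUnit_left h3

lemma tau_sum (j : ℕ) (hj : 0 < j) : ∑ a : ZMod p, tau p a ^ j = if p - 1 ∣ j then ((p - 1 : ℕ) : ZMod (p^3)) else 0 := by
  split_ifs with h
  · have h0 : ∑ a : ZMod p, tau p a ^ j = ∑ a ∈ univ.erase (0 : ZMod p), tau p a ^ j := by
      rw [← add_sum_erase _ _ (mem_univ (0 : ZMod p)), tau_zero, zero_pow hj.ne', zero_add]
    rw [h0]
    have h1 : ∀ a ∈ univ.erase (0 : ZMod p), tau p a ^ j = 1 := by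
      intro a ha
      obtain ⟨k, rfl⟩ := h
      rw [← tau_pow, pow_mul, ZMod.pow_card_sub_one_eq_one (ne_of_mem_erase ha), one_pow, tau_one]
    rw [sum_congr rfl h1]
    simp [ZMod.card]
  · obtain ⟨g, hg⟩ := IsCyclic.exists_generator (α := (ZMod p)ˣ)
    have hord : orderOf g = p - 1 := by
      rw [orderOf_eq_card_of_forall_mem_zpowers hg, Nat.card_eq_fintype_card, ZMod.card_units]
    have hgj : (g : ZMod p)^j - 1 ≠ 0 := by
      intro h0
      apply h
      rw [← hord]
      apply orderOf_dvd_of_pow_eq_one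
      ext
      push_cast
      exact sub_eq_zero.mp h0
    have hu : IsUnit (tau p g ^ j - 1) := by
      apply red_unit
      rw [map_sub, map_pow, red_tau, map_one]
      exact hgj
    have e : tau p g ^ j * ∑ a : ZMod p, tau p a ^ j = ∑ a : ZMod p, tau p a ^ j := by
      rw [mul_sum]
      refine Fintype.sum_bijective (fun a => (g : ZMod p) * a) (Units.mulLeft_bijective g) _ _ ?_
      intro a
      rw [tau_mul, mul_pow]
    apply hu.mul_left_cancel
    rw [sub_mul, e]; simp

variable {m : ℕ}

lemma quad_lift (hpm : p = 4*m+1) (a : ZMod p) : 8 * ((quadraticChar (ZMod p) (1 - a) : ℤ) : ZMod (p^3)) =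
    15 * (1 - tau p a)^(2*m) - 10 * (1 - tau p a)^(6*m) + 3 * (1 - tau p a)^(10*m) := by
  have hm := m_pos hpm
  by_cases ha : a = 1
  · subst ha
    simp [tau_one, hm.ne']
  have ha' : 1 - a ≠ 0 := fun h => ha (sub_eq_zero.mp h).symm
  have hchar : ringChar (ZMod p) ≠ 2 := by rw [ZMod.ringChar_zmod_n]; omega
  have h1 := quadraticChar_eq_pow_of_char_ne_two' hchar (1 - a)
  have hsq := quadraticChar_sq_one ha'
  generalize quadraticChar (ZMod p) (1-a) = ε at *
  rw [ZMod.card, show p / 2 = 2*m by omega] at h1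
  have h2 : red p ((1 - tau p a)^(2*m) - (ε : ZMod (p^3))) = 0 := by
    rw [map_sub, map_pow, map_sub, red_tau, map_one, map_intCast, h1, sub_self]
  obtain ⟨s, hs⟩ := red_zero h2
  have hs' : (1 - tau p a)^(2*m) = (ε : ZMod (p^3)) + p * s := by rw [← hs]; ring
  have hε : (ε : ZMod (p^3))^2 = 1 := by exact_mod_cast congrArg (Int.cast : ℤ → ZMod (p^3)) hsq
  rw [show 6*m = 2*m*3 by ring, show 10*m = 2*m*5 by ring, pow_mul _ _ 3, pow_mul _ _ 5, hs']
  have h3 := p_cube (p := p)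
  generalize (ε : ZMod (p^3)) = e at *
  generalize (p : ZMod (p^3)) = P at *
  have : (15 * (e + P*s) - 10 * (e + P*s)^3 + 3*(e+P*s)^5) - 8 * e = P^3 * (s^3*(30*e^2-10+15*e*P*s+3*P^2*s^2)) + (e^2-1)*(3*e^3 + 15*e^2*(P*s) -7*e - 15*(P*s) + 30*e*(P*s)^2) := by ring
  rw [h3, hε] at this
  linear_combination -this

lemma power_sum (hpm : p = 4*m+1) (N : ℕ) : ∑ a : ZMod p, tau p a ^ (3*m) * (1 - tau p a)^N =
    ((4*m : ℕ) : ZMod (p^3)) * ∑ j ∈ (range (N+1)).filter (fun j => 4*m ∣ 3*m+j), (-1)^j * (N.choose j : ZMod (p^3)) := by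
  have hm := m_pos hpm
  have h1 : ∀ a : ZMod p, tau p a ^ (3*m) * (1 - tau p a)^N =
      ∑ j ∈ range (N+1), (-1)^j * (N.choose j : ZMod (p^3)) * tau p a ^ (3*m+j) := by
    intro a
    rw [sub_eq_neg_add, add_pow, mul_sum]
    apply sum_congr rfl
    intro j _
    rw [neg_pow, pow_add]; ring
  simp_rw [h1]
  rw [sum_comm, sum_filter, mul_sum]
  apply sum_congr rfl
  intro j _
  rw [← mul_sum, tau_sum _ (by omega), show p - 1 = 4*m by omega]
  split_ifs <;> ring

/-- The lifted Jacobi sum. -/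
lemma U_eq (hpm : p = 4*m+1) : 8 * ∑ a : ZMod p, tau p a ^ (3*m) * ((quadraticChar (ZMod p) (1 - a) : ℤ) : ZMod (p^3)) =
    (-1)^m * ((VV m : ℤ) : ZMod (p^3)) := by
  have hm := m_pos hpm
  have h1 : 8 * ∑ a : ZMod p, tau p a ^ (3*m) * ((quadraticChar (ZMod p) (1 - a) : ℤ) : ZMod (p^3)) =
     15 * (∑ a : ZMod p, tau p a ^ (3*m) * (1 - tau p a)^(2*m)) - 10 * (∑ a : ZMod p, tau p a ^ (3*m) * (1 - tau p a)^(6*m))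
     + 3 * ∑ a : ZMod p, tau p a ^ (3*m) * (1 - tau p a)^(10*m) := by
    simp only [mul_sum, ← sum_add_distrib, ← sum_sub_distrib]
    apply sum_congr rfl
    intro a _
    linear_combination (tau p a ^ (3*m)) * quad_lift hpm a
  have key : ∀ j : ℕ, j ≤ 10*m → (4*m ∣ 3*m+j ↔ j = m ∨ j = 5*m ∨ j = 9*m) := by
    intro j hj
    constructor
    · rintro ⟨k, hk⟩
      have k4 : k < 4 := by
        by_contra h
        have : 4*m*4 ≤ 4*m*k := Nat.mul_le_mul_left _ (by omega)
        omega
      interval_cases k <;> omega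
    · rintro (rfl | rfl | rfl)
      · exact ⟨1, by ring⟩
      · exact ⟨2, by ring⟩
      · exact ⟨3, by ring⟩
  have f1 : (range (2*m+1)).filter (fun j => 4*m ∣ 3*m+j) = {m} := by
    ext j; simp only [mem_filter, mem_range, mem_singleton]
    constructor
    · rintro ⟨h1, h2⟩; have := (key j (by omega)).mp h2; omega
    · rintro rfl; exact ⟨by omega, (key _ (by omega)).mpr (by omega)⟩
  have f2 : (range (6*m+1)).filter (fun j => 4*m ∣ 3*m+j) = {m, 5*m} := by
    ext j; simp only [mem_filter, mem_range, mem_singleton, mem_insert]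
    constructor
    · rintro ⟨h1, h2⟩; have := (key j (by omega)).mp h2; omega
    · intro h; exact ⟨by omega, (key _ (by omega)).mpr (by omega)⟩
  have f3 : (range (10*m+1)).filter (fun j => 4*m ∣ 3*m+j) = {m, 5*m, 9*m} := by
    ext j; simp only [mem_filter, mem_range, mem_singleton, mem_insert]
    constructor
    · rintro ⟨h1, h2⟩; have := (key j (by omega)).mp h2; omega
    · intro h; exact ⟨by omega, (key _ (by omega)).mpr (by omega)⟩
  rw [h1, power_sum hpm, power_sum hpm, power_sum hpm, f1, f2, f3, sum_singleton, sum_pair (by omega),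
    sum_insert (by simp; omega), sum_pair (by omega)]
  have c1 : (6*m).choose (5*m) = (6*m).choose m := Nat.choose_symm_of_eq_add (by ring)
  have c2 : (10*m).choose (9*m) = (10*m).choose m := Nat.choose_symm_of_eq_add (by ring)
  have s : ((-1 : ZMod (p^3))^m)^4 = 1 := by rw [← pow_mul, mul_comm, pow_mul]; norm_num
  have s5 : (-1 : ZMod (p^3))^(5*m) = (-1)^m := by
    rw [mul_comm, pow_mul]; linear_combination ((-1 : ZMod (p^3))^m) * s
  have s9 : (-1 : ZMod (p^3))^(9*m) = (-1)^m := by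
    rw [mul_comm, pow_mul]; linear_combination ((-1 : ZMod (p^3))^m) * (((-1 : ZMod (p^3))^m)^4 + 1) * s
  rw [c1, c2, s5, s9]
  unfold VV
  push_cast
  ring

end

lemma two_sq_unique (p : ℕ) (hp : p.Prime) (x y A B : ℤ) (h1 : (p:ℤ) = x^2 + 4*y^2)
    (h2 : (p:ℤ) = A^2 + B^2) (hA : Odd A) (hpo : Odd (p:ℤ)) : A^2 = x^2 := by
  have hpp : Prime (p:ℤ) := Nat.prime_iff_prime_int.mp hp
  have hp0 : (0:ℤ) < p := by exact_mod_cast hp.pos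
  have hx : Odd x := by
    by_contra h
    rw [Int.not_odd_iff_even] at h
    obtain ⟨k, rfl⟩ := h
    obtain ⟨l, hl⟩ := hpo
    have : (2:ℤ) * l + 1 = 2 * (2*k^2 + 2*y^2) := by rw [← hl, h1]; ring
    omega
  have hd : (p:ℤ) ∣ (2*A*y - B*x) * (2*A*y + B*x) := ⟨A^2 - x^2, by
    linear_combination (-A^2)*h1 + x^2*h2⟩
  -- a vanishing linear form kills oddness
  have key : ∀ C : ℤ, C^2 = B^2 → (p:ℤ) ∣ 2*A*y - C*x → A^2 = x^2 := by
    intro C hC ⟨k, hk⟩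
    have e : (A*x + 2*C*y)^2 + (2*A*y - C*x)^2 = p^2 := by
      have : (p:ℤ)^2 = (x^2+4*y^2)*(A^2+C^2) := by rw [hC, ← h1, ← h2]; ring
      rw [this]; ring
    rw [hk] at e
    have hne : A*x + 2*C*y ≠ 0 := by
      intro h0
      obtain ⟨l, hl⟩ := hA.mul hx
      rw [hl] at h0
      have : 2 * (l + C*y) = -1 := by linear_combination h0
      omega
    have hpos : 0 < (A*x + 2*C*y)^2 := by positivity
    have hk2 : k^2 < 1 := by
      by_contra h
      push Not at h
      have : (p:ℤ)^2 * 1 ≤ p^2 * k^2 := by gcongr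
      nlinarith
    have hk0 : k = 0 := by
      by_contra h
      have : 0 < k^2 := by positivity
      omega
    rw [hk0, mul_zero] at hk
    have e2 : (p:ℤ) * (A^2 - x^2) = 0 := by
      have : (p:ℤ) * (A^2 - x^2) = (2*A*y - C*x) * (2*A*y+C*x) := by
        linear_combination (A^2)*h1 - x^2*h2 + x^2 * hC
      rw [this, hk, zero_mul]
    rcases mul_eq_zero.mp e2 with h | h
    · omega
    · omega
  rcases hpp.dvd_or_dvd hd with h | h
  · exact key B rfl h
  · exact key (-B) (by ring) (by rwa [neg_mul, sub_neg_eq_add])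

section
variable {p : ℕ} [hp : Fact p.Prime]
variable {m : ℕ}

/-- The quartic character with values in the Gaussian integers. -/
lemma exists_chi (hpm : p = 4*m+1) : ∃ (χ : MulChar (ZMod p) GaussianInt) (f : GaussianInt →+* ZMod (p^3)),
    (∀ a, f (χ a) = tau p a ^ (3*m)) ∧ ∃ a, χ a ^ 2 = -1 := by
  have hm := m_pos hpm
  obtain ⟨g, hg⟩ := IsCyclic.exists_generator (α := (ZMod p)ˣ)
  have hord : orderOf g = 4*m := by
    rw [orderOf_eq_card_of_forall_mem_zpowers hg, Nat.card_eq_fintype_card, ZMod.card_units]; omega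
  let i0 : GaussianInt := ⟨0, 1⟩
  have hi0 : i0 * i0 = -1 := by ext <;> simp [i0]
  let I : GaussianIntˣ := ⟨i0, -i0, by rw [mul_neg, hi0, neg_neg], by rw [neg_mul, hi0, neg_neg]⟩
  have hI : I ∈ rootsOfUnity (Fintype.card (ZMod p)ˣ) GaussianInt := by
    rw [mem_rootsOfUnity, ZMod.card_units, show p - 1 = 2*(2*m) by omega, pow_mul]
    have : I^2 = -1 := by ext1; push_cast; rw [pow_two]; exact hi0
    rw [this, pow_mul]; simp
  let χ := MulChar.ofRootOfUnity hI hg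
  have hχ : χ g = i0 := MulChar.ofRootOfUnity_spec hI hg
  have hg2 : (g : ZMod p)^(2*m) = -1 := by
    have h1 : ((g : ZMod p)^(2*m))^2 = 1 := by
      rw [← pow_mul, show 2*m*2 = 4*m by ring, ← hord]
      have := pow_orderOf_eq_one g
      have := congrArg Units.val this
      push_cast at this
      exact this
    rcases (show (g : ZMod p)^(2*m) = 1 ∨ (g : ZMod p)^(2*m) = -1 by simpa using h1) with h | h
    · exfalso
      have : g^(2*m) = 1 := by ext; push_cast; exact h
      have := Nat.le_of_dvd (by omega) (orderOf_dvd_of_pow_eq_one this)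
      omega
    · exact h
  have hodd : Odd p := ⟨2*m, by omega⟩
  have hr : tau p g ^ (3*m) * tau p g ^ (3*m) = ((-1:ℤ) : ZMod (p^3)) := by
    rw [← pow_add, ← tau_pow, show 3*m+3*m = 2*m*3 by ring, pow_mul, hg2]
    norm_num
    exact tau_neg_one hodd
  let f : GaussianInt →+* ZMod (p^3) := Zsqrtd.lift ⟨tau p g ^ (3*m), hr⟩
  have hf : f i0 = tau p g ^ (3*m) := by simp [f, i0, Zsqrtd.lift]
  refine ⟨χ, f, ?_, g, by rw [hχ, pow_two, hi0]⟩
  intro a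
  by_cases ha : a = 0
  · subst ha
    rw [MulChar.map_zero, map_zero, tau_zero, zero_pow (by omega)]
  · obtain ⟨k, hk⟩ := (mem_powers_iff_mem_zpowers (x := g) (y := Units.mk0 a ha)).mpr (hg _)
    have : a = (g : ZMod p)^k := by
      have := congrArg Units.val hk
      simpa using this.symm
    rw [this, map_pow, map_pow, hχ, hf, tau_pow, ← pow_mul, ← pow_mul, mul_comm]

lemma exists_A (hpm : p = 4*m+1) : ∃ A B : ℤ, Odd A ∧ (p:ℤ) = A^2 + B^2 ∧ (p:ℤ)^3 ∣ VV m * (16*((-1)^m*A) - VV m) - 64*p := by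
  have hm := m_pos hpm
  obtain ⟨χ, f, hf, g, hg⟩ := exists_chi hpm
  let φ : MulChar (ZMod p) GaussianInt := (quadraticChar (ZMod p)).ringHomComp (Int.castRingHom _)
  have hφ : ∀ a, φ a = ((quadraticChar (ZMod p) a : ℤ) : GaussianInt) := fun a => rfl
  have hchar : ringChar (ZMod p) ≠ 2 := by rw [ZMod.ringChar_zmod_n]; omega
  have hsq : φ * φ = 1 := by
    refine MulChar.ext fun a => ?_
    rw [MulChar.mul_apply, hφ, MulChar.one_apply a.isUnit, ← Int.cast_mul, ← pow_two,
      quadraticChar_sq_one a.ne_zero, Int.cast_one]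
  have hg0 : IsUnit g := by
    by_contra h
    rw [MulChar.map_nonunit _ h] at hg
    have := congrArg Zsqrtd.re hg
    simp at this
  have hχ2 : χ * χ ≠ 1 := by
    intro h
    have : (χ * χ) g = 1 := by rw [h, MulChar.one_apply hg0]
    rw [MulChar.mul_apply, ← pow_two, hg] at this
    have := congrArg Zsqrtd.re this
    simp at this
  have hχ1 : χ ≠ 1 := by rintro rfl; simp at hχ2
  have hφ1 : φ ≠ 1 := by
    rw [MulChar.ringHomComp_ne_one_iff (RingHom.injective_int _)]
    exact quadraticChar_ne_one hchar
  have hχφ : χ * φ ≠ 1 := by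
    intro h
    apply hχ2
    have : (χ * φ) * (χ * φ) = χ * χ * (φ * φ) := mul_mul_mul_comm _ _ _ _
    rw [h, hsq] at this
    simpa using this.symm
  -- absolute value
  have hinj : Function.Injective GaussianInt.toComplex := fun a b h => GaussianInt.toComplex_inj.mp h
  have habs : (jacobiSum χ φ).norm = p := by
    have hn : ∀ {ψ : MulChar (ZMod p) GaussianInt}, ψ ≠ 1 → ψ.ringHomComp GaussianInt.toComplex ≠ 1 :=
      fun h => (MulChar.ringHomComp_ne_one_iff hinj).mpr h
    have := jacobiSum_mul_jacobiSum_inv (F := ZMod p) (F' := ℂ) (by rw [ZMod.ringChar_zmod_n, ringChar.eq_zero]; omega)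
      (hn hχ1) (hn hφ1) (by rw [← MulChar.ringHomComp_mul]; exact hn hχφ)
    rw [← MulChar.star_eq_inv, ← MulChar.star_eq_inv] at this
    have e : jacobiSum (star (χ.ringHomComp GaussianInt.toComplex)) (star (φ.ringHomComp GaussianInt.toComplex)) =
        star (jacobiSum (χ.ringHomComp GaussianInt.toComplex) (φ.ringHomComp GaussianInt.toComplex)) := by
      unfold jacobiSum
      rw [star_sum]
      apply sum_congr rfl
      intro a _
      rw [MulChar.star_apply, MulChar.star_apply, star_mul']
    rw [e, jacobiSum_ringHomComp] at this
    change _ * (starRingEnd ℂ) _ = _ at this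
    rw [Complex.mul_conj, ← GaussianInt.intCast_real_norm, ZMod.card] at this
    exact_mod_cast this
  -- parity
  have hone : (jacobiSum χ φ) + 1 = ∑ a ∈ univ.erase (1 : ZMod p), χ a * (φ (1 - a) - 1) := by
    have h0 := MulChar.sum_eq_zero_of_ne_one hχ1
    have h2 : ∑ a, χ a * (φ (1-a) - 1) = jacobiSum χ φ := by
      unfold jacobiSum
      simp only [mul_sub, mul_one, sum_sub_distrib, h0, sub_zero]
    rw [← h2, ← add_sum_erase _ _ (mem_univ (1 : ZMod p))]
    rw [sub_self, MulChar.map_one, MulChar.map_zero]; ring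
  have hpar : (2 : GaussianInt) ∣ jacobiSum χ φ + 1 := by
    rw [hone]
    apply dvd_sum
    intro a ha
    apply Dvd.dvd.mul_left
    have ha' : 1 - a ≠ 0 := fun h => ne_of_mem_erase ha (sub_eq_zero.mp h).symm
    rw [hφ]
    rcases quadraticChar_dichotomy ha' with h | h <;> rw [h]
    · simp
    · exact ⟨-1, by push_cast; ring⟩
  -- lift
  have hfJ : f (jacobiSum χ φ) = ∑ a : ZMod p, tau p a ^ (3*m) * ((quadraticChar (ZMod p) (1 - a) : ℤ) : ZMod (p^3)) := by
    unfold jacobiSum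
    rw [map_sum]
    apply sum_congr rfl
    intro a _
    rw [map_mul, hf, hφ, map_intCast]
  have hU := U_eq hpm
  rw [← hfJ] at hU
  generalize jacobiSum χ φ = J at *
  refine ⟨J.re, J.im, ?_, ?_, ?_⟩
  · obtain ⟨z, hz⟩ := hpar
    have := congrArg Zsqrtd.re hz
    simp at this
    exact ⟨z.re - 1, by linarith⟩
  · rw [← habs, Zsqrtd.norm_def]; ring
  · have h1 : J * star J = (p : GaussianInt) := by
      have := Zsqrtd.norm_eq_mul_conj J
      rw [← this, habs]; simp
    have h2 : J + star J = ((2 * J.re : ℤ) : GaussianInt) := by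
      ext
      · simp; ring
      · simp
    have h3 := congrArg f h1
    have h4 := congrArg f h2
    rw [map_mul, map_natCast] at h3
    rw [map_add, map_intCast] at h4
    have s : ((-1 : ZMod (p^3))^m)^2 = 1 := by rw [← pow_mul, mul_comm, pow_mul]; norm_num
    have h5 : (((VV m * (16*((-1)^m*J.re) - VV m) - 64*p : ℤ)) : ZMod (p^3)) = 0 := by
      push_cast
      push_cast at h4
      have v : ((VV m : ℤ) : ZMod (p^3)) = (-1)^m * (8 * f J) := by
        linear_combination (-(-1 : ZMod (p^3))^m) * hU - ((VV m : ℤ) : ZMod (p^3)) * s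
      rw [v]
      generalize (-1 : ZMod (p^3))^m = σ at *
      linear_combination 64 * h3 + (64 * f J * (2 * (J.re : ZMod (p^3)) - f J)) * s - 64 * f J * h4
    rw [ZMod.intCast_zmod_eq_zero_iff_dvd] at h5
    exact_mod_cast h5

end

theorem statement1 (p : ℕ) (hp : p.Prime) (h1 : p % 4 = 1)
    (x y : ℤ) (hxy : (p : ℤ) = x^2 + 4*y^2) :
    ratCongr p 3
      (∑ k ∈ Finset.range p, (k:ℚ)^2 * ((2*k).choose k : ℚ)^3 / 64^k)
      ((x:ℚ)^2/6 - (p:ℚ)/12 - (p:ℚ)^2/(24*(x:ℚ)^2)) := by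
  have : Fact p.Prime := ⟨hp⟩
  obtain ⟨m, hpm⟩ : ∃ m, p = 4*m+1 := ⟨p/4, by omega⟩
  obtain ⟨A, B, hA, hAB, hG⟩ := exists_A hpm
  have hodd : Odd (p:ℤ) := ⟨2*m, by rw [hpm]; push_cast; ring⟩
  have hAx := two_sq_unique p hp x y A B hxy hAB hA hodd
  have hs : ((-1:ℤ)^m)^2 = 1 := by rw [← pow_mul, mul_comm, pow_mul]; simp
  have hx : ¬ (p:ℤ) ∣ x := by
    intro hd
    have hdy : (p:ℤ) ∣ 4*y^2 := by
      have := dvd_sub (dvd_refl (p:ℤ)) (hd.mul_left x)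
      rwa [show (p:ℤ) - x*x = 4*y^2 by linear_combination hxy] at this
    by_cases hx0 : x = 0
    · rw [hx0] at hxy
      obtain ⟨k, hk⟩ := hodd
      omega
    · obtain ⟨k, rfl⟩ := hd
      have hk : k ≠ 0 := by rintro rfl; simp at hx0
      have h1 : 1 ≤ k^2 := by have : 0 < k^2 := by positivity
                              omega
      have hp2 : (2:ℤ) ≤ p := by exact_mod_cast hp.two_le
      nlinarith [sq_nonneg y, mul_le_mul_of_nonneg_left h1 (sq_nonneg (p:ℤ))]
  have key := final_cg hpm x ((-1)^m*A) hx (by rw [mul_pow, hs, one_mul, hAx]) hG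
  have e : ∑ k ∈ Finset.range p, (k:ℚ)^2 * ((2*k).choose k : ℚ)^3 / 64^k =
      ∑ k ∈ Finset.range p, (k:ℚ)^2 * bb k ^ 3 := by
    apply Finset.sum_congr rfl
    intro k _
    rw [bb_eq, div_pow, ← pow_mul, mul_comm k 3, pow_mul]
    norm_num
    ring
  unfold ratCongr
  rw [e]
  exact key.num_dvd
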